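/- arXiv:2405.16319 — 3 statements merged into one kernel-verified Lean document; each statement's English description precedes it below -/
import Mathlib

section
/- Let 𝔟 denote the Bergman kernel 𝔟(z,w) = (1 − z·conj(w))^{−2} on the unit disc. There exist a real number r with 0 < r < 1, a nonempty index set Λ, and a family (s_λ)_{λ∈Λ} of complete Pick kernels on the disc r𝔻 = {z ∈ ℂ : |z| < r} with the following two properties: (i) for every λ ∈ Λ there exists a positive kernel h_λ on r𝔻 with 𝔟(z,w) = (1 − h_λ(z,w))·s_λ(z,w) for all z, w ∈ r𝔻; and (ii) there do NOT exist a complete Pick kernel s on r𝔻, a positive kernel h on r𝔻 with 𝔟 = (1 − h)·s on r𝔻, and positive kernels f_λ on r𝔻 with s_λ(z,w) = s(z,w)·f_λ(z,w) on r𝔻 for every λ ∈ Λ. -/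
open Matrix
open scoped ComplexOrder

noncomputable section

/-- `k` is a positive (semi-definite) kernel on `X`: every Gram sum is a nonnegative real
(using the partial order on `ℂ`, so `0 ≤ w` means `w` is real and nonnegative). -/
def IsPosKernel {X : Type*} (k : X → X → ℂ) : Prop :=
  ∀ (n : ℕ) (z : Fin n → X) (c : Fin n → ℂ),
    0 ≤ ∑ i, ∑ j, (starRingEnd ℂ) (c i) * c j * k (z i) (z j)

/-- Positive semidefiniteness of the block matrix `[ℓ(z i, z j)·I − k(z i, z j)·W i (W j)ᴴ]`. -/
def PickBlockPSD {X : Type*} (k ℓ : X → X → ℂ) {n N : ℕ}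
    (z : Fin n → X) (W : Fin n → Matrix (Fin N) (Fin N) ℂ) : Prop :=
  ∀ u : Fin n → (Fin N → ℂ),
    0 ≤ ∑ i, ∑ j,
      star (u i) ⬝ᵥ ((ℓ (z i) (z j) • (1 : Matrix (Fin N) (Fin N) ℂ)
        - k (z i) (z j) • (W i * (W j)ᴴ)) *ᵥ u j)

/-- `Φ` is a contractive multiplier from `k` to `ℓ`. -/
def IsContractiveMultiplier {X : Type*} (k ℓ : X → X → ℂ) {N : ℕ}
    (Φ : X → Matrix (Fin N) (Fin N) ℂ) : Prop :=
  ∀ (n : ℕ) (z : Fin n → X), PickBlockPSD k ℓ z fun i => Φ (z i)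

/-- `(k, ℓ)` is a complete Pick pair. -/
def IsCompletePickPair {X : Type*} (k ℓ : X → X → ℂ) : Prop :=
  ∀ (n N : ℕ), 1 ≤ n → 1 ≤ N →
    ∀ (z : Fin n → X) (W : Fin n → Matrix (Fin N) (Fin N) ℂ),
      PickBlockPSD k ℓ z W →
      ∃ Φ : X → Matrix (Fin N) (Fin N) ℂ,
        IsContractiveMultiplier k ℓ Φ ∧ ∀ i, Φ (z i) = W i

/-- The Bergman kernel `𝔟(z,w) = (1 − z·conj w)^{−2}` of the unit disc. -/
def bergman (z w : ℂ) : ℂ := ((1 - z * (starRingEnd ℂ) w) ^ 2)⁻¹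

/-- The open disc of radius `r` about `0`, as a type. -/
abbrev Disc (r : ℝ) := {z : ℂ // ‖z‖ < r}


theorem exists_isometry_of_gram {ι V : Type*} [Fintype ι] [DecidableEq ι] [NormedAddCommGroup V]
    [InnerProductSpace ℂ V] [FiniteDimensional ℂ V] (x y : ι → V)
    (hxy : ∀ i j, inner ℂ (x i) (x j) = inner ℂ (y i) (y j)) :
    ∃ L : V →ₗᵢ[ℂ] V, ∀ i, L (x i) = y i := by
  let Tx : (ι → ℂ) →ₗ[ℂ] V := Fintype.linearCombination ℂ x
  let Ty : (ι → ℂ) →ₗ[ℂ] V := Fintype.linearCombination ℂ y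
  have hn : ∀ c, ‖Tx c‖ = ‖Ty c‖ := by
    intro c
    have : inner ℂ (Tx c) (Tx c) = inner ℂ (Ty c) (Ty c) := by
      simp only [Tx, Ty, Fintype.linearCombination_apply, sum_inner, inner_sum, inner_smul_left,
        inner_smul_right, hxy]
    rw [inner_self_eq_norm_sq_to_K, inner_self_eq_norm_sq_to_K] at this
    have h2 : ‖Tx c‖ ^ 2 = ‖Ty c‖ ^ 2 := by exact_mod_cast this
    exact (sq_eq_sq₀ (norm_nonneg _) (norm_nonneg _)).1 h2
  obtain ⟨g, hg⟩ := LinearMap.exists_rightInverse_of_surjective Tx.rangeRestrict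
    (LinearMap.range_rangeRestrict Tx)
  have hg' : ∀ v, Tx (g v) = (v : V) := by
    intro v
    have := congrArg Subtype.val (LinearMap.congr_fun hg v)
    simpa using this
  let L0 : LinearMap.range Tx →ₗᵢ[ℂ] V :=
    { toLinearMap := Ty ∘ₗ g
      norm_map' := by
        intro v
        change ‖Ty (g v)‖ = ‖v‖
        rw [← hn, hg']; rfl }
  refine ⟨L0.extend, fun i => ?_⟩
  have hx : Tx (Pi.single i 1) = x i := by simp [Tx]
  have hy : Ty (Pi.single i 1) = y i := by simp [Ty]
  have hm : x i ∈ LinearMap.range Tx := ⟨_, hx⟩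
  have h1 := L0.extend_apply ⟨x i, hm⟩
  change L0.extend (x i) = _ at h1
  rw [h1]
  change Ty (g ⟨x i, hm⟩) = y i
  rw [← hy, ← sub_eq_zero, ← map_sub, ← norm_eq_zero, ← hn, map_sub, hg', hx]
  simp

/-- weighted Szego-type kernel -/
def sker {X : Type*} (d u : X → ℂ) (z w : X) : ℂ :=
  d z * (starRingEnd ℂ) (d w) * (1 - u z * (starRingEnd ℂ) (u w))⁻¹

theorem one_sub_ne {a b : ℂ} (ha : ‖a‖ < 1) (hb : ‖b‖ < 1) : 1 - a * (starRingEnd ℂ) b ≠ 0 := by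
  intro h
  have h1 : a * (starRingEnd ℂ) b = 1 := (sub_eq_zero.1 h).symm
  have h2 : ‖a‖ * ‖b‖ = 1 := by
    rw [← RCLike.norm_conj b, ← norm_mul, h1, norm_one]
  nlinarith [norm_nonneg a, norm_nonneg b]

theorem norm_snd_le2 {E K : Type*} [NormedAddCommGroup E]
    [NormedAddCommGroup K] (x : WithLp 2 (E × K)) : ‖x.snd‖ ≤ ‖x‖ := by
  have := WithLp.prod_norm_sq_eq_of_L2 x
  nlinarith [norm_nonneg x, norm_nonneg x.snd, sq_nonneg ‖x.fst‖]

theorem exists_fix {E K : Type*} [NormedAddCommGroup E] [InnerProductSpace ℂ E]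
    [NormedAddCommGroup K] [InnerProductSpace ℂ K] [CompleteSpace K]
    (L : WithLp 2 (E × K) →ₗᵢ[ℂ] WithLp 2 (E × K)) (c : ℂ) (hc : ‖c‖ < 1) (e : E) :
    ∃ h : K, (L (WithLp.toLp 2 (e, c • h))).snd = h ∧
      ∀ h', (L (WithLp.toLp 2 (e, c • h'))).snd = h' → h' = h := by
  have hC : ContractingWith ‖c‖₊ (fun h : K => (L (WithLp.toLp 2 (e, c • h))).snd) := by
    refine ⟨by exact_mod_cast hc, LipschitzWith.of_dist_le_mul fun a b => ?_⟩
    rw [dist_eq_norm, dist_eq_norm, ← WithLp.sub_snd, ← map_sub, ← WithLp.toLp_sub, Prod.mk_sub_mk,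
      sub_self, ← smul_sub]
    refine (norm_snd_le2 _).trans ?_
    rw [L.norm_map, WithLp.norm_toLp_snd, norm_smul]
    rfl
  exact ⟨hC.fixedPoint, hC.fixedPoint_isFixedPt, fun h' hh => hC.fixedPoint_unique hh⟩

theorem quad_expand {X : Type*} (k : X → X → ℂ) {n N : ℕ}
    (z : Fin n → X) (W : Fin n → Matrix (Fin N) (Fin N) ℂ) (u : Fin n → (Fin N → ℂ)) :
    (∑ i, ∑ j,
      star (u i) ⬝ᵥ ((k (z i) (z j) • (1 : Matrix (Fin N) (Fin N) ℂ)
        - k (z i) (z j) • (W i * (W j)ᴴ)) *ᵥ u j)) =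
    ∑ i, ∑ j, ∑ p, ∑ q, (starRingEnd ℂ) (u i p) * u j q *
      (k (z i) (z j) * ((1 : Matrix (Fin N) (Fin N) ℂ) p q - (W i * (W j)ᴴ) p q)) := by
  refine Finset.sum_congr rfl fun i _ => Finset.sum_congr rfl fun j _ => ?_
  simp only [dotProduct, mulVec, Finset.mul_sum]
  refine Finset.sum_congr rfl fun p _ => Finset.sum_congr rfl fun q _ => ?_
  simp [Matrix.sub_apply, Matrix.smul_apply]
  ring

open scoped MatrixOrder in
theorem posSemidef_factor {ι : Type*} [Fintype ι] [DecidableEq ι] {M : Matrix ι ι ℂ}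
    (hM : M.PosSemidef) : ∃ B : Matrix ι ι ℂ, M = Bᴴ * B :=
  CStarAlgebra.nonneg_iff_eq_star_mul_self.mp hM.nonneg

theorem sker_pick {X : Type*} (d u : X → ℂ) (hd : ∀ z, d z ≠ 0) (hu : ∀ z, ‖u z‖ < 1) :
    IsCompletePickPair (sker d u) (sker d u) := by
  intro n N _ _ z W hW
  let ι := Fin n × Fin N
  let M : Matrix ι ι ℂ := fun a b => (1 - u (z a.1) * (starRingEnd ℂ) (u (z b.1)))⁻¹ *
    ((1 : Matrix (Fin N) (Fin N) ℂ) a.2 b.2 - (W a.1 * (W b.1)ᴴ) a.2 b.2)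
  have hM : M.PosSemidef := by
    rw [Matrix.posSemidef_iff_dotProduct_mulVec]
    have key : ∀ x : ι → ℂ, 0 ≤ star x ⬝ᵥ (M *ᵥ x) := by
      intro x
      have h := hW (fun i p => (starRingEnd ℂ (d (z i)))⁻¹ * x (i, p))
      rw [quad_expand] at h
      convert h using 1
      simp only [dotProduct, mulVec, Finset.mul_sum, ι, Fintype.sum_prod_type]
      refine Finset.sum_congr rfl fun i _ => ?_
      rw [Finset.sum_comm]
      refine Finset.sum_congr rfl fun j _ => Finset.sum_congr rfl fun p _ =>
        Finset.sum_congr rfl fun q _ => ?_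
      have h1 := hd (z i)
      have h2 : (starRingEnd ℂ) (d (z j)) ≠ 0 := by simpa using hd (z j)
      simp only [M, sker, map_mul, map_inv₀, Complex.conj_conj, Pi.star_apply, RCLike.star_def]
      field_simp
    refine ⟨?_, key⟩
    ext a b
    rw [conjTranspose_apply]
    have h1 : star ((1 : Matrix (Fin N) (Fin N) ℂ) b.2 a.2) = (1 : Matrix (Fin N) (Fin N) ℂ) a.2 b.2 := by
      rw [← conjTranspose_apply, conjTranspose_one]
    have h2 : star ((W b.1 * (W a.1)ᴴ) b.2 a.2) = (W a.1 * (W b.1)ᴴ) a.2 b.2 := by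
      rw [← conjTranspose_apply, conjTranspose_mul, conjTranspose_conjTranspose]
    change star ((1 - u (z b.1) * (starRingEnd ℂ) (u (z a.1)))⁻¹ *
      ((1 : Matrix (Fin N) (Fin N) ℂ) b.2 a.2 - (W b.1 * (W a.1)ᴴ) b.2 a.2)) =
      (1 - u (z a.1) * (starRingEnd ℂ) (u (z b.1)))⁻¹ *
      ((1 : Matrix (Fin N) (Fin N) ℂ) a.2 b.2 - (W a.1 * (W b.1)ᴴ) a.2 b.2)
    rw [star_mul', star_sub, h1, h2]
    congr 1
    simp [mul_comm]
  obtain ⟨B, hB⟩ := posSemidef_factor hM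
  let Hc : ι → EuclideanSpace ℂ ι := fun a => WithLp.toLp 2 (fun k => B k a)
  have hHc : ∀ a b, inner ℂ (Hc a) (Hc b) = M a b := by
    intro a b
    rw [hB, EuclideanSpace.inner_eq_star_dotProduct, Matrix.mul_apply, dotProduct]
    simp [Hc, mul_comm]
  have hMe : ∀ a b : ι, (1 - u (z a.1) * (starRingEnd ℂ) (u (z b.1))) * M a b =
      (1 : Matrix (Fin N) (Fin N) ℂ) a.2 b.2 - (W a.1 * (W b.1)ᴴ) a.2 b.2 := by
    intro a b
    exact mul_inv_cancel_left₀ (one_sub_ne (hu _) (hu _)) _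
  let e : Fin N → EuclideanSpace ℂ (Fin N) := fun q => EuclideanSpace.single q 1
  have he : ∀ p q, inner ℂ (e p) (e q) = (1 : Matrix (Fin N) (Fin N) ℂ) p q := by
    intro p q
    simp only [e, Matrix.one_apply, EuclideanSpace.inner_single_left]
    simp
  let f : ι → EuclideanSpace ℂ (Fin N) := fun a =>
    WithLp.toLp 2 (fun p => (starRingEnd ℂ) (W a.1 a.2 p))
  have hf : ∀ a b, inner ℂ (f a) (f b) = (W a.1 * (W b.1)ᴴ) a.2 b.2 := by
    intro a b
    rw [EuclideanSpace.inner_eq_star_dotProduct, Matrix.mul_apply, dotProduct]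
    simp [f, mul_comm]
  obtain ⟨L, hL⟩ := exists_isometry_of_gram
    (V := WithLp 2 (EuclideanSpace ℂ (Fin N) × EuclideanSpace ℂ ι))
    (fun a : ι => WithLp.toLp 2 (e a.2, (starRingEnd ℂ) (u (z a.1)) • Hc a))
    (fun a : ι => WithLp.toLp 2 (f a, Hc a)) (by
      intro a b
      simp only [WithLp.prod_inner_apply, inner_smul_left, inner_smul_right, hHc, he, hf,
        Complex.conj_conj]
      linear_combination -(hMe a b))
  have hc : ∀ x, ‖(starRingEnd ℂ) (u x)‖ < 1 := fun x => by simpa using hu x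
  choose H hH1 hH2 using fun (x : X) (q : Fin N) => exists_fix L _ (hc x) (e q)
  let G : X → Fin N → EuclideanSpace ℂ (Fin N) := fun x q =>
    (L (WithLp.toLp 2 (e q, (starRingEnd ℂ) (u x) • H x q))).fst
  have hLG : ∀ x q, L (WithLp.toLp 2 (e q, (starRingEnd ℂ) (u x) • H x q)) =
      WithLp.toLp 2 (G x q, H x q) := by
    intro x q
    have := hH1 x q
    apply WithLp.ofLp_injective
    exact Prod.ext rfl this
  let Φ : X → Matrix (Fin N) (Fin N) ℂ := fun x q p => (starRingEnd ℂ) (G x q p)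
  have hΦ : ∀ x y p q, (Φ x * (Φ y)ᴴ) p q = inner ℂ (G x p) (G y q) := by
    intro x y p q
    rw [EuclideanSpace.inner_eq_star_dotProduct, Matrix.mul_apply, dotProduct]
    refine Finset.sum_congr rfl fun r _ => ?_
    rw [conjTranspose_apply]
    change (starRingEnd ℂ) (G x p r) * (starRingEnd ℂ) ((starRingEnd ℂ) (G y q r)) =
      G y q r * (starRingEnd ℂ) (G x p r)
    rw [Complex.conj_conj, mul_comm]
  have hfin : ∀ x y p q, (1 : Matrix (Fin N) (Fin N) ℂ) p q - (Φ x * (Φ y)ᴴ) p q =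
      (1 - u x * (starRingEnd ℂ) (u y)) * inner ℂ (H x p) (H y q) := by
    intro x y p q
    have h := L.inner_map_map (WithLp.toLp 2 (e p, (starRingEnd ℂ) (u x) • H x p))
      (WithLp.toLp 2 (e q, (starRingEnd ℂ) (u y) • H y q))
    rw [hLG, hLG] at h
    simp only [WithLp.prod_inner_apply, inner_smul_left, inner_smul_right, he,
        Complex.conj_conj] at h
    rw [hΦ]
    linear_combination -h
  refine ⟨Φ, ?_, ?_⟩
  · intro m y v
    rw [quad_expand]
    have : (∑ i, ∑ j, ∑ p, ∑ q, (starRingEnd ℂ) (v i p) * v j q *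
      (sker d u (y i) (y j) * ((1 : Matrix (Fin N) (Fin N) ℂ) p q - (Φ (y i) * (Φ (y j))ᴴ) p q))) =
      inner ℂ (∑ i, ∑ p, ((starRingEnd ℂ) (d (y i)) * v i p) • H (y i) p)
        (∑ i, ∑ p, ((starRingEnd ℂ) (d (y i)) * v i p) • H (y i) p) := by
      rw [sum_inner]
      refine Finset.sum_congr rfl fun i _ => ?_
      rw [inner_sum]
      refine Finset.sum_congr rfl fun j _ => ?_
      rw [sum_inner]
      refine Finset.sum_congr rfl fun p _ => ?_
      rw [inner_sum]
      refine Finset.sum_congr rfl fun q _ => ?_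
      rw [hfin, inner_smul_left, inner_smul_right]
      have := one_sub_ne (hu (y i)) (hu (y j))
      simp only [sker, map_mul, Complex.conj_conj]
      field_simp
    rw [this, inner_self_eq_norm_sq_to_K]
    have h0 : (0 : ℝ) ≤ ‖∑ i, ∑ p, ((starRingEnd ℂ) (d (y i)) * v i p) • H (y i) p‖ ^ 2 :=
      sq_nonneg _
    have h1 := Complex.zero_le_real.2 h0
    push_cast at h1
    exact h1
  · intro i
    ext q p
    have h1 : Hc (i, q) = H (z i) q := by
      apply hH2
      rw [hL (i, q)]
      rfl
    have h2 : G (z i) q = f (i, q) := by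
      change (L (WithLp.toLp 2 (e q, (starRingEnd ℂ) (u (z i)) • H (z i) q))).fst = _
      rw [← h1, hL (i, q)]
      rfl
    simp [Φ, h2, f]

theorem IsPosKernel.congr {X : Type*} {K K' : X → X → ℂ} (h : IsPosKernel K)
    (hk : ∀ z w, K' z w = K z w) : IsPosKernel K' := by
  have : K' = K := by funext z w; exact hk z w
  rwa [this]

theorem IsPosKernel.scale {X : Type*} {K : X → X → ℂ} (h : IsPosKernel K) (α : X → ℂ) :
    IsPosKernel (fun z w => α z * K z w * (starRingEnd ℂ) (α w)) := by
  intro n z c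
  convert h n z (fun i => (starRingEnd ℂ) (α (z i)) * c i) using 1
  refine Finset.sum_congr rfl fun i _ => Finset.sum_congr rfl fun j _ => ?_
  simp only [map_mul, Complex.conj_conj]
  ring

theorem IsPosKernel.two {X : Type*} {K : X → X → ℂ} (h : IsPosKernel K) (z w : X) (x y : ℂ) :
    0 ≤ (starRingEnd ℂ) x * x * K z z + (starRingEnd ℂ) x * y * K z w +
      ((starRingEnd ℂ) y * x * K w z + (starRingEnd ℂ) y * y * K w w) := by
  have := h 2 ![z, w] ![x, y]
  simpa [Fin.sum_univ_two] using this

theorem IsPosKernel.self {X : Type*} {K : X → X → ℂ} (h : IsPosKernel K) (z : X) :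
    0 ≤ K z z := by
  have := h.two z z 1 0
  simpa using this

theorem IsPosKernel.self_re {X : Type*} {K : X → X → ℂ} (h : IsPosKernel K) (z : X) :
    0 ≤ (K z z).re := (Complex.le_def.1 (h.self z)).1

theorem IsPosKernel.self_eq {X : Type*} {K : X → X → ℂ} (h : IsPosKernel K) (z : X) :
    K z z = ((K z z).re : ℂ) := by
  have := (Complex.le_def.1 (h.self z)).2
  apply Complex.ext <;> simp
  simpa using this.symm

theorem IsPosKernel.symm {X : Type*} {K : X → X → ℂ} (h : IsPosKernel K) (z w : X) :
    K w z = (starRingEnd ℂ) (K z w) := by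
  have h1 := (Complex.le_def.1 (h.two z w 1 1)).2
  have h2 := (Complex.le_def.1 (h.two z w 1 Complex.I)).2
  have hz := (Complex.le_def.1 (h.self z)).2
  have hw := (Complex.le_def.1 (h.self w)).2
  simp at h1 h2 hz hw
  apply Complex.ext <;> simp <;> linarith

theorem IsPosKernel.cs {X : Type*} {K : X → X → ℂ} (h : IsPosKernel K) (z w : X) :
    ‖K z w‖ ^ 2 ≤ (K z z).re * (K w w).re := by
  have key : ∀ t : ℝ, 0 ≤ (K z z).re * t ^ 2 * ‖K z w‖ ^ 2 - 2 * t * ‖K z w‖ ^ 2 + (K w w).re := by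
    intro t
    have h1 := (Complex.le_def.1 (h.two z w (-(t * K z w)) 1)).1
    rw [h.symm z w, h.self_eq z, h.self_eq w] at h1
    rw [← Complex.normSq_eq_norm_sq, Complex.normSq_apply]
    simp at h1
    ring_nf at h1 ⊢
    linarith
  have hz := h.self_re z
  have hw := h.self_re w
  rcases hz.eq_or_lt with h0 | h0
  · have k2 := key (((K w w).re + 1) / ‖K z w‖ ^ 2)
    rw [← h0] at k2 ⊢
    rcases eq_or_ne (‖K z w‖ ^ 2) 0 with h3 | h3
    · rw [h3]; simp
    · exfalso
      have e : 2 * (((K w w).re + 1) / ‖K z w‖ ^ 2) * ‖K z w‖ ^ 2 = 2 * ((K w w).re + 1) := by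
        rw [mul_assoc, div_mul_cancel₀ _ h3]
      rw [e] at k2
      linarith
  · have k := key (1 / (K z z).re)
    field_simp at k
    nlinarith

theorem pos_schur {X : Type*} {k : X → X → ℂ} {φ : X → ℂ} (h : IsPosKernel k)
    (hT : IsPosKernel fun z w => k z w * (1 - φ z * (starRingEnd ℂ) (φ w))) (o : X)
    (ho : k o o ≠ 0) :
    IsPosKernel fun z w => (k z w - k z o * k o w / k o o) *
      (1 - φ z * (starRingEnd ℂ) (φ w)) := by
  intro n z c
  have hre : (starRingEnd ℂ) (k o o) = k o o := (h.symm o o).symm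
  have hpos : 0 < (k o o).re := by
    refine lt_of_le_of_ne (h.self_re o) fun h0 => ho ?_
    rw [h.self_eq o, ← h0]; simp
  let Z : Fin (n + 1) → X := Fin.cons o z
  let C : Fin (n + 1) → ℂ := Fin.cons (-(∑ j, c j * k o (z j)) / k o o) c
  let S : ℂ := ∑ j, C j * k o (Z j)
  let R : ℂ := ∑ j, C j * (starRingEnd ℂ) (φ (Z j)) * k o (Z j)
  have hS : S = 0 := by
    simp only [S, C, Z, Fin.sum_univ_succ, Fin.cons_zero, Fin.cons_succ]
    field_simp
    ring
  have hS' : ∑ j, (starRingEnd ℂ) (C j) * k (Z j) o = (starRingEnd ℂ) S := by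
    simp only [S, map_sum, map_mul]
    exact Finset.sum_congr rfl fun j _ => by rw [h.symm o (Z j)]
  have hR' : ∑ j, (starRingEnd ℂ) (C j) * φ (Z j) * k (Z j) o = (starRingEnd ℂ) R := by
    simp only [R, map_sum, map_mul, Complex.conj_conj]
    exact Finset.sum_congr rfl fun j _ => by rw [h.symm o (Z j)]
  have h1 := hT (n + 1) Z C
  have h2 : (∑ i, ∑ j, (starRingEnd ℂ) (C i) * C j *
      (k (Z i) (Z j) * (1 - φ (Z i) * (starRingEnd ℂ) (φ (Z j))))) =
      (∑ i, ∑ j, (starRingEnd ℂ) (C i) * C j *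
      ((k (Z i) (Z j) - k (Z i) o * k o (Z j) / k o o) *
        (1 - φ (Z i) * (starRingEnd ℂ) (φ (Z j))))) + (starRingEnd ℂ) S * S / k o o
        - (starRingEnd ℂ) R * R / k o o := by
    rw [← hS', ← hR']
    simp only [S, R, Finset.sum_mul_sum, Finset.sum_div, ← Finset.sum_add_distrib,
      ← Finset.sum_sub_distrib]
    refine Finset.sum_congr rfl fun i _ => Finset.sum_congr rfl fun j _ => ?_
    ring
  have h3 : (∑ i, ∑ j, (starRingEnd ℂ) (C i) * C j *
      ((k (Z i) (Z j) - k (Z i) o * k o (Z j) / k o o) *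
        (1 - φ (Z i) * (starRingEnd ℂ) (φ (Z j))))) =
      ∑ i, ∑ j, (starRingEnd ℂ) (c i) * c j * ((k (z i) (z j) - k (z i) o * k o (z j) / k o o) *
      (1 - φ (z i) * (starRingEnd ℂ) (φ (z j)))) := by
    simp [C, Z, Fin.sum_univ_succ, ho]
  have h4 : 0 ≤ (starRingEnd ℂ) R * R / k o o := by
    have : (starRingEnd ℂ) R * R / k o o = ((Complex.normSq R / (k o o).re : ℝ) : ℂ) := by
      rw [mul_comm, Complex.mul_conj]
      push_cast
      rw [← h.self_eq o]
    rw [this]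
    exact Complex.zero_le_real.2 (div_nonneg (Complex.normSq_nonneg _) hpos.le)
  rw [h2, h3, hS] at h1
  simp only [mul_zero, zero_div, add_zero, sub_nonneg] at h1
  exact h4.trans h1

theorem pos_schur' {X : Type*} {k : X → X → ℂ} (h : IsPosKernel k) (o : X)
    (ho : k o o ≠ 0) :
    IsPosKernel fun z w => (k z w - k z o * k o w / k o o) := by
  have := pos_schur (φ := fun _ => 0) h (h.congr fun z w => by simp) o ho
  exact this.congr fun z w => by simp

theorem pos_of_hasSum {X : Type*} (v : X → ℂ) (a : ℕ → ℝ) (ha : ∀ n, 0 ≤ a n) (F : X → X → ℂ)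
    (hF : ∀ z w, HasSum (fun n => (a n : ℂ) * (v z * (starRingEnd ℂ) (v w)) ^ n) (F z w)) :
    IsPosKernel F := by
  intro m z c
  have hs : HasSum (fun n => ∑ i, ∑ j, (starRingEnd ℂ) (c i) * c j *
      ((a n : ℂ) * (v (z i) * (starRingEnd ℂ) (v (z j))) ^ n))
      (∑ i, ∑ j, (starRingEnd ℂ) (c i) * c j * F (z i) (z j)) :=
    hasSum_sum fun i _ => hasSum_sum fun j _ => (hF (z i) (z j)).mul_left _
  refine hs.nonneg fun n => ?_
  have : (∑ i, ∑ j, (starRingEnd ℂ) (c i) * c j *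
      ((a n : ℂ) * (v (z i) * (starRingEnd ℂ) (v (z j))) ^ n)) =
      ((a n * Complex.normSq (∑ i, (starRingEnd ℂ) (c i) * (v (z i)) ^ n) : ℝ) : ℂ) := by
    push_cast
    rw [← Complex.mul_conj]
    simp only [map_sum, map_mul, map_pow, Complex.conj_conj]
    rw [Finset.sum_mul_sum, Finset.mul_sum]
    refine Finset.sum_congr rfl fun i _ => ?_
    rw [Finset.mul_sum]
    refine Finset.sum_congr rfl fun j _ => ?_
    ring
  rw [this]
  exact Complex.zero_le_real.2 (mul_nonneg (ha n) (Complex.normSq_nonneg _))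

theorem norm_mul_conj_lt {a b : ℂ} (ha : ‖a‖ < 1) (hb : ‖b‖ < 1) :
    ‖a * (starRingEnd ℂ) b‖ < 1 := by
  rw [norm_mul, RCLike.norm_conj]
  nlinarith [norm_nonneg a, norm_nonneg b]

theorem sker_pos {X : Type*} (d u : X → ℂ) (hu : ∀ z, ‖u z‖ < 1) : IsPosKernel (sker d u) := by
  have h := pos_of_hasSum u (fun _ => 1) (fun _ => zero_le_one)
    (fun z w => (1 - u z * (starRingEnd ℂ) (u w))⁻¹) (fun z w => by
      simpa using hasSum_geometric_of_norm_lt_one (norm_mul_conj_lt (hu z) (hu w)))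
  exact (h.scale d).congr fun z w => by simp only [sker]; ring

theorem h_pos {X : Type*} (v : X → ℂ) (hv : ∀ z, ‖v z‖ < 1) :
    IsPosKernel (fun z w => (v z * (starRingEnd ℂ) (v w)) ^ 2 /
      (1 - v z * (starRingEnd ℂ) (v w)) ^ 2) := by
  have h := pos_of_hasSum v (fun n => n + 1) (fun n => by positivity)
    (fun z w => 1 / (1 - v z * (starRingEnd ℂ) (v w)) ^ 2) (fun z w => by
      simpa using hasSum_choose_mul_geometric_of_norm_lt_one 1 (norm_mul_conj_lt (hv z) (hv w)))
  exact (h.scale fun z => v z ^ 2).congr fun z w => by simp only [map_pow]; ring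

theorem pick_two {X : Type*} {k : X → X → ℂ} (h : IsPosKernel k) (hp : IsCompletePickPair k k)
    (hk : ∀ z w, k z w ≠ 0) (o a b : X) :
    ‖1 - k a o * k o b / (k o o * k a b)‖ ^ 2 ≤
      (1 - k a o * k o a / (k o o * k a a)).re * (1 - k b o * k o b / (k o o * k b b)).re := by
  have hpos : ∀ z, 0 < (k z z).re := fun z => by
    refine lt_of_le_of_ne (h.self_re z) fun h0 => hk z z ?_
    rw [h.self_eq z, ← h0]; simp
  set t : ℝ := 1 - ‖k a b‖ ^ 2 / ((k a a).re * (k b b).re) with ht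
  have ht0 : 0 ≤ t := by
    rw [ht, sub_nonneg, div_le_one (mul_pos (hpos a) (hpos b))]
    exact h.cs a b
  have hst : ((Real.sqrt t : ℝ) : ℂ) * ((Real.sqrt t : ℝ) : ℂ) = t := by
    rw [← Complex.ofReal_mul, Real.mul_self_sqrt ht0]
  have h1t : (1 - t : ℂ) * (k a a * k b b) = k a b * k b a := by
    rw [h.symm a b, Complex.mul_conj, Complex.normSq_eq_norm_sq, h.self_eq a, h.self_eq b]
    have h1 := (hpos a).ne'
    have h2 := (hpos b).ne'
    have : (1 - t) * ((k a a).re * (k b b).re) = ‖k a b‖ ^ 2 := by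
      rw [ht]; field_simp; ring
    exact_mod_cast this
  let y : Fin 2 → ℂ := ![((Real.sqrt t : ℝ) : ℂ), 0]
  let WW : Fin 2 → Matrix (Fin 1) (Fin 1) ℂ := fun i => Matrix.of fun _ _ => y i
  have hWW : ∀ i j p q, (WW i * (WW j)ᴴ) p q = y i * (starRingEnd ℂ) (y j) := by
    intro i j p q
    rw [Matrix.mul_apply, Fin.sum_univ_one, conjTranspose_apply]
    rfl
  obtain ⟨Φ, hΦ, hW⟩ := hp 2 1 (by norm_num) le_rfl ![a, b] WW (by
      intro u
      rw [quad_expand]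
      simp only [hWW, Fin.sum_univ_one, Matrix.one_apply_eq]
      have : (∑ i, ∑ j, (starRingEnd ℂ) (u i 0) * u j 0 *
          (k (![a, b] i) (![a, b] j) * (1 - y i * (starRingEnd ℂ) (y j))))
          = ((Complex.normSq (u 0 0 * k b a + u 1 0 * k b b) / (k b b).re : ℝ) : ℂ) := by
        push_cast
        rw [← Complex.mul_conj, ← h.self_eq b]
        simp only [Fin.sum_univ_two, y, Matrix.cons_val_zero, Matrix.cons_val_one,
          Complex.conj_ofReal, hst, map_zero, mul_zero, sub_zero, mul_one, map_add, map_mul,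
          zero_mul]
        rw [← h.symm b a, ← h.symm b b]
        have := hk b b
        field_simp
        have h2 : k a a * (1 - t) * k b b = k a b * k b a := by rw [← h1t]; ring
        linear_combination (starRingEnd ℂ) (u 0 0) * u 0 0 * h2
      rw [this]
      exact Complex.zero_le_real.2 (div_nonneg (Complex.normSq_nonneg _) (hpos b).le))
  let φ : X → ℂ := fun z => Φ z 0 0
  have hφa : φ a = ((Real.sqrt t : ℝ) : ℂ) := by
    have : Φ a = WW 0 := hW 0
    change Φ a 0 0 = _
    rw [this]; rfl
  have hφb : φ b = 0 := by
    have : Φ b = WW 1 := hW 1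
    change Φ b 0 0 = _
    rw [this]; rfl
  have hT : IsPosKernel fun z w => k z w * (1 - φ z * (starRingEnd ℂ) (φ w)) := by
    intro n z c
    have := hΦ n z (fun i _ => c i)
    rw [quad_expand] at this
    simpa [Matrix.mul_apply, φ] using this
  have hc := (pos_schur h hT o (hk o o)).cs a b
  simp only [hφa, hφb, Complex.conj_ofReal, hst, map_zero, mul_zero, sub_zero, mul_one] at hc
  have e1 : k a b - k a o * k o b / k o o = k a b * (1 - k a o * k o b / (k o o * k a b)) := by
    have := hk a b
    field_simp
  have e2 : k b b - k b o * k o b / k o o =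
      ((k b b).re : ℂ) * (1 - k b o * k o b / (k o o * k b b)) := by
    rw [← h.self_eq b]
    have := hk b b
    field_simp
  have e3 : (k a a - k a o * k o a / k o o) * (1 - t) =
      (((k a a).re * (1 - t) : ℝ) : ℂ) * (1 - k a o * k o a / (k o o * k a a)) := by
    push_cast
    rw [← h.self_eq a]
    have := hk a a
    field_simp
  rw [e1, e2, e3, Complex.re_ofReal_mul, Complex.re_ofReal_mul, norm_mul, mul_pow] at hc
  have hab : 0 < ‖k a b‖ ^ 2 := by have := hk a b; positivity
  have h1t' : (k a a).re * (1 - t) * (k b b).re = ‖k a b‖ ^ 2 := by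
    have h1 := (hpos a).ne'
    have h2 := (hpos b).ne'
    rw [ht]; field_simp; ring
  refine le_of_mul_le_mul_left (hc.trans (le_of_eq ?_)) hab
  rw [← h1t']
  ring

theorem real_ineq (σ S b x y : ℝ) (hσ : 1 ≤ σ) (hS : 0 < S)
    (hbS : 0 ≤ 1 - b / S)
    (h : (x - 1) ^ 2 + y ^ 2 ≤ (1 - b / S) * (1 - 1 / σ) * (x ^ 2 + y ^ 2)) :
    b * ((x ^ 2 + y ^ 2) / (σ * S)) ≤ 1 := by
  have hσ0 : 0 < σ := by linarith
  rcases hσ.eq_or_lt with h1 | h1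
  · subst h1
    have hx : (x - 1) ^ 2 + y ^ 2 ≤ 0 := by simpa using h
    have hx1 : x = 1 := by nlinarith [sq_nonneg (x - 1), sq_nonneg y]
    have hy1 : y = 0 := by nlinarith [sq_nonneg (x - 1), sq_nonneg y]
    subst hx1; subst hy1
    have : b * ((1 ^ 2 + 0 ^ 2) / (1 * S)) = b / S := by ring
    linarith
  · set Y := b * ((x ^ 2 + y ^ 2) / (σ * S)) with hY
    have e : σ * ((1 - b / S) * (1 - 1 / σ) * (x ^ 2 + y ^ 2)) =
        (σ - 1) * (x ^ 2 + y ^ 2 - σ * Y) := by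
      rw [hY]; field_simp
    have h2 : σ * ((x - 1) ^ 2 + y ^ 2) ≤ (σ - 1) * (x ^ 2 + y ^ 2 - σ * Y) := by
      rw [← e]; exact mul_le_mul_of_nonneg_left h hσ0.le
    have h3 : 0 ≤ σ * (σ - 1) * (1 - Y) := by nlinarith [sq_nonneg (x - σ), sq_nonneg y]
    have h4 : 0 < σ * (σ - 1) := mul_pos hσ0 (by linarith)
    have h5 : 0 ≤ 1 - Y := nonneg_of_mul_nonneg_right h3 h4
    linarith

theorem limit_ineq (W γ : ℝ) (hW0 : 0 ≤ W) (hW : W < 1 / 4)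
    (h : ∀ τ : ℝ, 0 < τ → τ < 1 / 4 → (2 * τ * W - 4 * τ ^ 2 * W ^ 2) ^ 2 ≤ 2 * τ ^ 2 * γ) :
    2 * W ^ 2 ≤ γ := by
  by_contra hc
  push Not at hc
  set δ := 4 * W ^ 2 - 2 * γ with hδ
  have hδ0 : 0 < δ := by linarith
  set τ := min (1 / 8) (δ / 32) with hτ
  have t0 : 0 < τ := lt_min (by norm_num) (by linarith)
  have t1 : τ ≤ 1 / 8 := min_le_left _ _
  have t2 : τ ≤ δ / 32 := min_le_right _ _
  have h1 := h τ t0 (by linarith)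
  have h2 : τ ^ 2 * (2 * W - 4 * τ * W ^ 2) ^ 2 ≤ τ ^ 2 * (2 * γ) := by
    calc _ = (2 * τ * W - 4 * τ ^ 2 * W ^ 2) ^ 2 := by ring
      _ ≤ _ := h1
      _ = _ := by ring
  have h3 := le_of_mul_le_mul_left h2 (by positivity)
  have h4 : W ^ 3 ≤ 1 := pow_le_one₀ hW0 (by linarith)
  have h5 : τ * W ^ 3 ≤ τ := by nlinarith
  nlinarith [sq_nonneg (4 * τ * W ^ 2)]

theorem pos_diag {X : Type*} {k : X → X → ℂ} (h : IsPosKernel k) {z : X} (hz : k z z ≠ 0) :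
    0 < (k z z).re := by
  refine lt_of_le_of_ne (h.self_re z) fun h0 => hz ?_
  rw [h.self_eq z, ← h0]; simp

theorem rigid (s h f : Disc (1 / 4) → Disc (1 / 4) → ℂ) (hs : IsPosKernel s)
    (hp : IsCompletePickPair s s) (hh : IsPosKernel h) (hf : IsPosKernel f)
    (hb : ∀ z w : Disc (1 / 4), bergman ↑z ↑w = (1 - h z w) * s z w)
    (hsf : ∀ z w : Disc (1 / 4), (1 - 2 * (z * (starRingEnd ℂ) (w : ℂ)))⁻¹ = s z w * f z w)
    (o : Disc (1 / 4)) (ho : (o : ℂ) = 0) (z w : Disc (1 / 4)) :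
    s z o * s o w = s o o * s z w * (1 - 2 * (z * (starRingEnd ℂ) (w : ℂ))) := by
  have hlt : ∀ z : Disc (1 / 4), ‖(z : ℂ)‖ < 1 := fun z => z.2.trans (by norm_num)
  have hx : ∀ z w : Disc (1 / 4), ‖(z : ℂ) * (starRingEnd ℂ) (w : ℂ)‖ ≤ 1 / 16 := by
    intro z w
    rw [norm_mul, RCLike.norm_conj]
    nlinarith [norm_nonneg (z : ℂ), norm_nonneg (w : ℂ), z.2, w.2]
  have hx2 : ∀ z w : Disc (1 / 4), 1 - 2 * ((z : ℂ) * (starRingEnd ℂ) (w : ℂ)) ≠ 0 := by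
    intro z w h0
    have h1 : 2 * ((z : ℂ) * (starRingEnd ℂ) (w : ℂ)) = 1 := (sub_eq_zero.1 h0).symm
    have h2 := congrArg norm h1
    rw [norm_mul] at h2
    have := hx z w
    norm_num at h2
    norm_num at this
    linarith
  have hbne : ∀ z w : Disc (1 / 4), bergman (z : ℂ) w ≠ 0 := fun z w =>
    inv_ne_zero (pow_ne_zero _ (one_sub_ne (hlt z) (hlt w)))
  have hk : ∀ z w, s z w ≠ 0 := fun z w h0 => hbne z w (by rw [hb, h0, mul_zero])
  have hpos : ∀ z, 0 < (s z z).re := fun z => pos_diag hs (hk z z)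
  have hfe : ∀ z w, f z w = (s z w)⁻¹ * (1 - 2 * ((z : ℂ) * (starRingEnd ℂ) (w : ℂ)))⁻¹ := by
    intro z w
    rw [hsf z w, inv_mul_cancel_left₀ (hk z w)]
  have hhe : ∀ z w, h z w = 1 - bergman (z : ℂ) w / s z w := by
    intro z w
    rw [hb z w, mul_div_cancel_right₀ _ (hk z w)]; ring
  set σ := (s o o).re with hσ
  have hσc : s o o = (σ : ℂ) := hs.self_eq o
  have hσ0 : 0 < σ := hpos o
  have hσ1 : 1 ≤ σ := by
    have h1 := hh.self_re o
    rw [hhe, hσc, ho] at h1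
    have : (1 - bergman 0 0 / (σ : ℂ)) = ((1 - 1 / σ : ℝ) : ℂ) := by simp [bergman]
    rw [this, Complex.ofReal_re, sub_nonneg, div_le_one hσ0] at h1
    exact h1
  let G : Disc (1 / 4) → Disc (1 / 4) → ℂ := fun z w => 1 - s z o * s o w / (s o o * s z w)
  have hG : ∀ a b, ‖G a b‖ ^ 2 ≤ (G a a).re * (G b b).re := fun a b => pick_two hs hp hk o a b
  let α : Disc (1 / 4) → ℂ := fun z => s z o * (((Real.sqrt σ)⁻¹ : ℝ) : ℂ)
  let E : Disc (1 / 4) → Disc (1 / 4) → ℂ := fun z w =>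
    α z * (f z w - f z o * f o w / f o o) * (starRingEnd ℂ) (α w)
  have hfoo : f o o ≠ 0 := by
    rw [hfe]; exact mul_ne_zero (inv_ne_zero (hk _ _)) (inv_ne_zero (hx2 _ _))
  have hE : IsPosKernel E := (pos_schur' hf o hfoo).scale α
  have hEG : ∀ z w, E z w * (1 - 2 * ((z : ℂ) * (starRingEnd ℂ) (w : ℂ))) =
      (1 - G z w) - (1 - 2 * ((z : ℂ) * (starRingEnd ℂ) (w : ℂ))) := by
    intro z w
    have h1 : (((Real.sqrt σ)⁻¹ : ℝ) : ℂ) * (((Real.sqrt σ)⁻¹ : ℝ) : ℂ) = (s o o)⁻¹ := by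
      rw [← Complex.ofReal_mul, ← mul_inv, Real.mul_self_sqrt hσ0.le, hσc, Complex.ofReal_inv]
    have h2 : E z w = (s o o)⁻¹ * (s z o * s o w * (f z w - f z o * f o w / f o o)) := by
      simp only [E, α, map_mul, Complex.conj_ofReal]
      rw [← hs.symm w o, ← h1]; ring
    rw [h2, hfe z w, hfe z o, hfe o w, hfe o o, ho]
    simp only [G]
    have a1 := hk z w
    have a2 := hk z o
    have a3 := hk o w
    have a4 := hk o o
    have a5 := hx2 z w
    simp only [map_zero, mul_zero, zero_mul, sub_zero, inv_one, mul_one]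
    generalize (1 - 2 * ((z : ℂ) * (starRingEnd ℂ) (w : ℂ))) = D at a5 ⊢
    field_simp
    ring
  have hxx : ∀ z : Disc (1 / 4), (z : ℂ) * (starRingEnd ℂ) (z : ℂ) = ((‖(z : ℂ)‖ ^ 2 : ℝ) : ℂ) := by
    intro z
    rw [Complex.mul_conj, Complex.normSq_eq_norm_sq]
  have hEd : ∀ z, (E z z).re * (1 - 2 * ‖(z : ℂ)‖ ^ 2) =
      (1 - (G z z).re) - (1 - 2 * ‖(z : ℂ)‖ ^ 2) := by
    intro z
    have h1 := hEG z z
    rw [hxx, hE.self_eq z] at h1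
    have h2 := congrArg Complex.re h1
    have e : (1 - 2 * ((‖(z : ℂ)‖ ^ 2 : ℝ) : ℂ)) = ((1 - 2 * ‖(z : ℂ)‖ ^ 2 : ℝ) : ℂ) := by
      push_cast; ring
    rw [e, ← Complex.ofReal_mul, Complex.ofReal_re, Complex.sub_re, Complex.sub_re,
      Complex.ofReal_re, Complex.one_re] at h2
    exact h2
  have hGd : ∀ z, 1 - (G z z).re ≤ (1 - ‖(z : ℂ)‖ ^ 2) ^ 2 := by
    intro z
    have ht : ‖(z : ℂ)‖ ^ 2 < 1 := by nlinarith [norm_nonneg (z : ℂ), hlt z]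
    set t := ‖(z : ℂ)‖ ^ 2 with htd
    have hbz : bergman (z : ℂ) z = (((1 - t) ^ 2)⁻¹ : ℝ) := by
      rw [bergman, hxx, ← htd]; push_cast; rfl
    have hhz : h z z = ((1 - ((1 - t) ^ 2)⁻¹ / (s z z).re : ℝ) : ℂ) := by
      rw [hhe, hbz]
      conv_lhs => rw [hs.self_eq z]
      push_cast; rfl
    have hho : h o o = ((1 - 1 / σ : ℝ) : ℂ) := by
      rw [hhe, hσc, ho]; simp [bergman]
    have hhzo : h z o * s z o = s z o - 1 := by
      have := hb z o
      rw [ho] at this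
      simp [bergman] at this
      linear_combination this
    have c1 := hh.cs z o
    rw [hhz, hho, Complex.ofReal_re, Complex.ofReal_re] at c1
    have c2 := hh.self_re z
    rw [hhz, Complex.ofReal_re] at c2
    have hn : ∀ p : ℂ, ‖p‖ ^ 2 = p.re ^ 2 + p.im ^ 2 := by
      intro p
      rw [← Complex.normSq_eq_norm_sq, Complex.normSq_apply]; ring
    have c3 : ((s z o).re - 1) ^ 2 + (s z o).im ^ 2 ≤
        (1 - ((1 - t) ^ 2)⁻¹ / (s z z).re) * (1 - 1 / σ) * ((s z o).re ^ 2 + (s z o).im ^ 2) := by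
      have e1 : ((s z o).re - 1) ^ 2 + (s z o).im ^ 2 = ‖h z o‖ ^ 2 * ‖s z o‖ ^ 2 := by
        rw [← mul_pow, ← norm_mul, hhzo, hn]; simp
      rw [e1, ← hn]
      exact mul_le_mul_of_nonneg_right c1 (sq_nonneg _)
    have c4 := real_ineq σ (s z z).re _ _ _ hσ1 (hpos z) c2 c3
    have hGz : 1 - G z z = ((((s z o).re ^ 2 + (s z o).im ^ 2) / (σ * (s z z).re) : ℝ) : ℂ) := by
      simp only [G]
      rw [hs.symm z o, Complex.mul_conj, Complex.normSq_eq_norm_sq, hn, hσc]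
      conv_lhs => rw [hs.self_eq z]
      push_cast; ring
    have hGz' := congrArg Complex.re hGz
    rw [Complex.ofReal_re, Complex.sub_re, Complex.one_re] at hGz'
    rw [hGz']
    have h1t : 0 < (1 - t) ^ 2 := pow_pos (by linarith) 2
    rwa [inv_mul_le_iff₀ h1t, mul_one] at c4
  have ht16 : ∀ z : Disc (1 / 4), ‖(z : ℂ)‖ ^ 2 ≤ 1 / 16 := by
    intro z
    nlinarith [norm_nonneg (z : ℂ), z.2]
  have hE2 : ∀ z, (E z z).re ≤ 2 * ‖(z : ℂ)‖ ^ 4 := by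
    intro z
    have h1 := hEd z
    have h2 := hGd z
    have h3 := hE.self_re z
    have h4 := ht16 z
    nlinarith
  have hEz : ∀ w, (E w w).re = 0 := by
    intro w
    have hlim : 2 * ‖(w : ℂ)‖ ^ 2 ≤ (G w w).re := by
      refine limit_ineq _ _ (norm_nonneg _) w.2 fun τ t0 t1 => ?_
      let z : Disc (1 / 4) := ⟨(τ : ℂ), by
        rw [Complex.norm_real, Real.norm_eq_abs, abs_of_pos t0]; exact t1⟩
      have hz : ‖(z : ℂ)‖ = τ := by
        change ‖(τ : ℂ)‖ = τ
        rw [Complex.norm_real, Real.norm_eq_abs, abs_of_pos t0]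
      have g1 : ‖E z w‖ ≤ 2 * τ ^ 2 * ‖(w : ℂ)‖ ^ 2 := by
        have c := hE.cs z w
        have c1 := hE2 z
        have c2 := hE2 w
        rw [hz] at c1
        refine abs_le_of_sq_le_sq' ?_ (by positivity) |>.2
        calc _ ≤ _ := c
          _ ≤ (2 * τ ^ 4) * (2 * ‖(w : ℂ)‖ ^ 4) :=
            mul_le_mul c1 c2 (hE.self_re w) (by positivity)
          _ = _ := by ring
      have g2 : ‖(1 : ℂ) - 2 * ((z : ℂ) * (starRingEnd ℂ) (w : ℂ))‖ ≤ 2 := by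
        have := norm_sub_le (1 : ℂ) (2 * ((z : ℂ) * (starRingEnd ℂ) (w : ℂ)))
        rw [norm_mul 2] at this
        have h3 := hx z w
        have h4 : ‖(2 : ℂ)‖ = 2 := by norm_num
        have h5 : ‖(1 : ℂ)‖ = 1 := by norm_num
        rw [h4, h5] at this
        linarith
      have g3 : 2 * ((z : ℂ) * (starRingEnd ℂ) (w : ℂ)) =
          G z w + E z w * (1 - 2 * ((z : ℂ) * (starRingEnd ℂ) (w : ℂ))) := by
        rw [hEG]; ring
      have g4 : 2 * τ * ‖(w : ℂ)‖ ≤ ‖G z w‖ + 4 * τ ^ 2 * ‖(w : ℂ)‖ ^ 2 := by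
        have e : 2 * τ * ‖(w : ℂ)‖ = ‖2 * ((z : ℂ) * (starRingEnd ℂ) (w : ℂ))‖ := by
          rw [norm_mul, norm_mul, RCLike.norm_conj, hz]
          norm_num
          ring
        rw [e, g3]
        refine (norm_add_le _ _).trans ?_
        gcongr
        rw [norm_mul]
        calc _ ≤ (2 * τ ^ 2 * ‖(w : ℂ)‖ ^ 2) * 2 :=
              mul_le_mul g1 g2 (norm_nonneg _) (by positivity)
          _ = _ := by ring
      have g5 : 0 ≤ 2 * τ * ‖(w : ℂ)‖ - 4 * τ ^ 2 * ‖(w : ℂ)‖ ^ 2 := by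
        have : 0 ≤ τ * ‖(w : ℂ)‖ := by positivity
        have h6 : τ * ‖(w : ℂ)‖ ≤ 1 / 2 := by nlinarith [w.2, norm_nonneg (w : ℂ)]
        nlinarith
      have hGw : 0 ≤ (G w w).re := by
        have h1 := hGd w
        have h4 := ht16 w
        nlinarith [sq_nonneg ‖(w : ℂ)‖]
      have hGz2 : (G z z).re ≤ 2 * τ ^ 2 := by
        have h1 := hEd z
        have h3 := hE.self_re z
        have h4 := ht16 z
        rw [hz] at h1 h4
        nlinarith
      calc _ ≤ ‖G z w‖ ^ 2 := pow_le_pow_left₀ g5 (by linarith) 2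
        _ ≤ _ := hG z w
        _ ≤ _ := mul_le_mul_of_nonneg_right hGz2 hGw
    have h1 := hEd w
    have h3 := hE.self_re w
    have h4 := ht16 w
    nlinarith
  have hE0 : E z w = 0 := by
    have c := hE.cs z w
    rw [hEz w, mul_zero] at c
    have : ‖E z w‖ = 0 := by nlinarith [norm_nonneg (E z w)]
    exact norm_eq_zero.1 this
  have h1 := hEG z w
  rw [hE0, zero_mul] at h1
  have h2 : s z o * s o w / (s o o * s z w) = 1 - G z w := by simp only [G]; ring
  have h3 : 1 - G z w = 1 - 2 * ((z : ℂ) * (starRingEnd ℂ) (w : ℂ)) := by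
    linear_combination -h1
  rw [h3, div_eq_iff (mul_ne_zero (hk _ _) (hk _ _))] at h2
  rw [h2]; ring

def phi (a : ℝ) (z : ℂ) : ℂ := (z - a) / (1 - a * z)

def dphi (a : ℝ) (z : ℂ) : ℂ := (1 - a ^ 2) / (1 - a * z) ^ 2

theorem den_lower {a : ℝ} (ha0 : 0 ≤ a) (ha : a ≤ 1 / 8) (z : Disc (1 / 4)) :
    31 / 32 ≤ ‖1 - (a : ℂ) * z‖ := by
  have h1 := norm_sub_norm_le (1 : ℂ) ((a : ℂ) * z)
  rw [norm_mul, Complex.norm_real, Real.norm_eq_abs, abs_of_nonneg ha0, norm_one] at h1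
  have hz := z.2
  nlinarith [norm_nonneg (z : ℂ)]

theorem den_ne {a : ℝ} (ha0 : 0 ≤ a) (ha : a ≤ 1 / 8) (z : Disc (1 / 4)) :
    1 - (a : ℂ) * z ≠ 0 := by
  have := den_lower ha0 ha z
  intro h0
  rw [h0, norm_zero] at this
  norm_num at this

theorem phi_norm {a : ℝ} (ha0 : 0 ≤ a) (ha : a ≤ 1 / 8) (z : Disc (1 / 4)) :
    ‖phi a z‖ < 1 / 2 := by
  have h1 := den_lower ha0 ha z
  rw [phi, norm_div, div_lt_iff₀ (by linarith)]
  have h2 := norm_sub_le (z : ℂ) (a : ℂ)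
  rw [Complex.norm_real, Real.norm_eq_abs, abs_of_nonneg ha0] at h2
  have hz := z.2
  linarith

theorem one_sub_sq_ne {a : ℝ} (ha0 : 0 ≤ a) (ha : a ≤ 1 / 8) : (1 - (a : ℂ) ^ 2) ≠ 0 := by
  have : (1 - a ^ 2) ≠ 0 := by nlinarith
  exact_mod_cast this

theorem dphi_ne {a : ℝ} (ha0 : 0 ≤ a) (ha : a ≤ 1 / 8) (z : Disc (1 / 4)) :
    dphi a z ≠ 0 :=
  div_ne_zero (one_sub_sq_ne ha0 ha) (pow_ne_zero _ (den_ne ha0 ha z))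

def uphi (a : ℝ) (z : ℂ) : ℂ := (Real.sqrt 2 : ℂ) * phi a z

theorem uphi_norm {a : ℝ} (ha0 : 0 ≤ a) (ha : a ≤ 1 / 8) (z : Disc (1 / 4)) :
    ‖uphi a z‖ < 1 := by
  have h1 := phi_norm ha0 ha z
  rw [uphi, norm_mul, Complex.norm_real, Real.norm_eq_abs, abs_of_nonneg (Real.sqrt_nonneg 2)]
  have h2 : Real.sqrt 2 ≤ 2 := by
    rw [Real.sqrt_le_iff]; norm_num
  nlinarith [norm_nonneg (phi a z), Real.sqrt_nonneg 2]

theorem uphi_mul (a : ℝ) (z w : ℂ) : uphi a z * (starRingEnd ℂ) (uphi a w) =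
    2 * (phi a z * (starRingEnd ℂ) (phi a w)) := by
  have h : (Real.sqrt 2 : ℂ) * (Real.sqrt 2 : ℂ) = 2 := by
    rw [← Complex.ofReal_mul, Real.mul_self_sqrt (by norm_num)]; norm_num
  simp only [uphi, map_mul, Complex.conj_ofReal]
  linear_combination (phi a z * (starRingEnd ℂ) (phi a w)) * h

def fam (a : ℝ) (z w : Disc (1 / 4)) : ℂ :=
  sker (fun z : Disc (1 / 4) => dphi a z) (fun z : Disc (1 / 4) => uphi a z) z w

theorem fam_eq (a : ℝ) (z w : Disc (1 / 4)) : fam a z w =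
    dphi a z * (starRingEnd ℂ) (dphi a w) *
      (1 - 2 * (phi a z * (starRingEnd ℂ) (phi a w)))⁻¹ := by
  rw [← uphi_mul]; rfl

theorem one_sub_phi {a : ℝ} (ha0 : 0 ≤ a) (ha : a ≤ 1 / 8) (z w : Disc (1 / 4)) :
    (1 - phi a z * (starRingEnd ℂ) (phi a w)) * ((1 - a * z) * (starRingEnd ℂ) (1 - a * w)) =
      (1 - (a : ℂ) ^ 2) * (1 - z * (starRingEnd ℂ) (w : ℂ)) := by
  have h1 := den_ne ha0 ha z
  have h2 : (1 - (a : ℂ) * (starRingEnd ℂ) (w : ℂ)) ≠ 0 := by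
    have := (map_ne_zero (starRingEnd ℂ)).2 (den_ne ha0 ha w)
    simpa using this
  have e : ∀ p q A B : ℂ, A ≠ 0 → B ≠ 0 → (1 - p / A * (q / B)) * (A * B) = A * B - p * q := by
    intro p q A B hA hB
    field_simp
  simp only [phi, map_div₀, map_sub, map_mul, map_one, Complex.conj_ofReal]
  rw [e _ _ _ _ h1 h2]
  ring

theorem two_phi_ne {a : ℝ} (ha0 : 0 ≤ a) (ha : a ≤ 1 / 8) (z w : Disc (1 / 4)) :
    1 - 2 * (phi a z * (starRingEnd ℂ) (phi a w)) ≠ 0 := by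
  rw [← uphi_mul]
  exact one_sub_ne (uphi_norm ha0 ha z) (uphi_norm ha0 ha w)

theorem fam_bergman {a : ℝ} (ha0 : 0 ≤ a) (ha : a ≤ 1 / 8) (z w : Disc (1 / 4)) :
    bergman (z : ℂ) w = (1 - (phi a z * (starRingEnd ℂ) (phi a w)) ^ 2 /
      (1 - phi a z * (starRingEnd ℂ) (phi a w)) ^ 2) * fam a z w := by
  rw [fam_eq]
  have e := one_sub_phi ha0 ha z w
  have n1 := two_phi_ne ha0 ha z w
  have n2 := den_ne ha0 ha z
  have n3 := (map_ne_zero (starRingEnd ℂ)).2 (den_ne ha0 ha w)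
  have n4 := one_sub_sq_ne ha0 ha
  have n5 : 1 - phi a z * (starRingEnd ℂ) (phi a w) ≠ 0 :=
    one_sub_ne ((phi_norm ha0 ha z).trans (by norm_num)) ((phi_norm ha0 ha w).trans (by norm_num))
  have n6 : 1 - (z : ℂ) * (starRingEnd ℂ) (w : ℂ) ≠ 0 :=
    one_sub_ne (z.2.trans (by norm_num)) (w.2.trans (by norm_num))
  have hd : (starRingEnd ℂ) (dphi a w) =
      (1 - (a : ℂ) ^ 2) / ((starRingEnd ℂ) (1 - (a : ℂ) * w)) ^ 2 := by
    simp [dphi]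
  rw [hd, dphi, bergman]
  generalize (starRingEnd ℂ) (1 - (a : ℂ) * w) = B at *
  generalize 1 - (a : ℂ) * (z : ℂ) = A at *
  generalize phi a z * (starRingEnd ℂ) (phi a w) = x at *
  generalize 1 - (z : ℂ) * (starRingEnd ℂ) (w : ℂ) = y at *
  generalize 1 - (a : ℂ) ^ 2 = c at *
  have e1 : 1 - x ^ 2 / (1 - x) ^ 2 = (1 - 2 * x) / (1 - x) ^ 2 := by
    field_simp; ring
  have e2 : y = (1 - x) * (A * B) / c := by
    rw [e]; field_simp
  rw [e1, e2]
  generalize 1 - x = X at *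
  generalize 1 - 2 * x = Y at *
  field_simp

theorem phi_zero (z : ℂ) : phi 0 z = z := by simp [phi]

theorem no_cert (s₀ h : Disc (1 / 4) → Disc (1 / 4) → ℂ) (hs : IsPosKernel s₀)
    (hp : IsCompletePickPair s₀ s₀) (hh : IsPosKernel h)
    (hb : ∀ z w : Disc (1 / 4), bergman ↑z ↑w = (1 - h z w) * s₀ z w)
    (f g : Disc (1 / 4) → Disc (1 / 4) → ℂ) (hf : IsPosKernel f) (hg : IsPosKernel g)
    (hsf : ∀ z w, fam 0 z w = s₀ z w * f z w)
    (hsg : ∀ z w, fam (1 / 8) z w = s₀ z w * g z w) : False := by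
  have a0 : (0 : ℝ) ≤ 1 / 8 := by norm_num
  have a1 : (1 / 8 : ℝ) ≤ 1 / 8 := le_rfl
  have hsf2 : ∀ z w : Disc (1 / 4),
      (1 - 2 * (z * (starRingEnd ℂ) (w : ℂ)))⁻¹ = s₀ z w * f z w := by
    intro z w
    rw [← hsf, fam_eq, phi_zero, phi_zero]; simp [dphi]
  let o : Disc (1 / 4) := ⟨0, by simp⟩
  have hr := rigid s₀ h f hs hp hh hf hb hsf2 o rfl
  have hk : ∀ z w, s₀ z w ≠ 0 := by
    intro z w h0
    have h1 := hb z w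
    rw [h0, mul_zero] at h1
    exact inv_ne_zero (pow_ne_zero _ (one_sub_ne (z.2.trans (by norm_num))
      (w.2.trans (by norm_num)))) h1
  have hσ0 : 0 < (s₀ o o).re := pos_diag hs (hk o o)
  have hσc := hs.self_eq o
  have hP : IsPosKernel (fun z w : Disc (1 / 4) => ((s₀ o o).re : ℂ) *
      (1 - 2 * (z * (starRingEnd ℂ) (w : ℂ))) *
      (1 - 2 * (phi (1 / 8) z * (starRingEnd ℂ) (phi (1 / 8) w)))⁻¹) := by
    refine (hg.scale fun z => s₀ z o / dphi (1 / 8) z).congr fun z w => ?_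
    have hge : g z w = fam (1 / 8) z w / s₀ z w := by
      rw [hsg, mul_div_cancel_left₀ _ (hk z w)]
    rw [hge, fam_eq, map_div₀, ← hs.symm w o, ← hσc]
    have m1 := hr z w
    have m2 := hk z w
    have m3 := dphi_ne a0 a1 z
    have m4 := (map_ne_zero (starRingEnd ℂ)).2 (dphi_ne a0 a1 w)
    have e : ∀ p q S S' k C : ℂ, p ≠ 0 → q ≠ 0 →
        S / p * (p * q * C / k) * (S' / q) = S * S' * C / k := by
      intro p q S S' k C hp hq
      field_simp
    rw [e _ _ _ _ _ _ m3 m4, m1]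
    field_simp
  let z : Disc (1 / 4) := ⟨((1 / 8 : ℝ) : ℂ), by rw [Complex.norm_real]; norm_num⟩
  let w : Disc (1 / 4) := ⟨((1 / 16 : ℝ) : ℂ), by rw [Complex.norm_real]; norm_num⟩
  have c := hP.cs z w
  have pz : phi (1 / 8) (z : ℂ) = 0 := by simp [phi, z]
  have pw : phi (1 / 8) (w : ℂ) = ((-8 / 127 : ℝ) : ℂ) := by
    simp only [phi, w]; push_cast; norm_num
  have hz : (z : ℂ) = ((1 / 8 : ℝ) : ℂ) := rfl
  have hw : (w : ℂ) = ((1 / 16 : ℝ) : ℂ) := rfl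
  simp only [pz, pw] at c
  simp only [hz, hw, Complex.conj_ofReal] at c
  generalize (s₀ o o).re = σ at c hσ0
  have e1 : (σ : ℂ) * (1 - 2 * (((1 / 8 : ℝ) : ℂ) * ((1 / 16 : ℝ) : ℂ))) *
      (1 - 2 * (0 * ((-8 / 127 : ℝ) : ℂ)))⁻¹ = ((σ * (63 / 64) : ℝ) : ℂ) := by
    push_cast; norm_num
  have e2 : (σ : ℂ) * (1 - 2 * (((1 / 8 : ℝ) : ℂ) * ((1 / 8 : ℝ) : ℂ))) *
      (1 - 2 * (0 * (starRingEnd ℂ) 0))⁻¹ = ((σ * (31 / 32) : ℝ) : ℂ) := by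
    push_cast; norm_num
  have e3 : (σ : ℂ) * (1 - 2 * (((1 / 16 : ℝ) : ℂ) * ((1 / 16 : ℝ) : ℂ))) *
      (1 - 2 * (((-8 / 127 : ℝ) : ℂ) * ((-8 / 127 : ℝ) : ℂ)))⁻¹ =
        ((σ * (127 / 128 * (16129 / 16001)) : ℝ) : ℂ) := by
    push_cast; ring_nf
  rw [e1, e2, e3, Complex.ofReal_re, Complex.ofReal_re, Complex.norm_real, Real.norm_eq_abs,
    sq_abs] at c
  nlinarith [mul_pos hσ0 hσ0]

/-- There are `0 < r < 1` and a family `(s_λ)` of complete Pick kernels on `r𝔻`, each of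
which factors the Bergman kernel as `𝔟 = (1 − h_λ)·s_λ`, but such that no single complete
Pick kernel `s` with `𝔟 = (1 − h)·s` is simultaneously a factor of every `s_λ`. -/
theorem bergman_no_minimum_certificate :
    ∃ r : ℝ, 0 < r ∧ r < 1 ∧
      ∃ (Λ : Type) (_ : Nonempty Λ) (s : Λ → Disc r → Disc r → ℂ),
        (∀ l, IsPosKernel (s l) ∧ IsCompletePickPair (s l) (s l)) ∧
        (∀ l, ∃ h : Disc r → Disc r → ℂ, IsPosKernel h ∧
          ∀ z w : Disc r, bergman ↑z ↑w = (1 - h z w) * s l z w) ∧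
        ¬ ∃ (s₀ h : Disc r → Disc r → ℂ),
            IsPosKernel s₀ ∧ IsCompletePickPair s₀ s₀ ∧ IsPosKernel h ∧
            (∀ z w : Disc r, bergman ↑z ↑w = (1 - h z w) * s₀ z w) ∧
            ∀ l, ∃ f : Disc r → Disc r → ℂ, IsPosKernel f ∧
              ∀ z w : Disc r, s l z w = s₀ z w * f z w := by
  have key : ∀ l : Bool, 0 ≤ (if l then (1 / 8 : ℝ) else 0) ∧
      (if l then (1 / 8 : ℝ) else 0) ≤ 1 / 8 := by
    intro l; cases l <;> norm_num
  refine ⟨1 / 4, by norm_num, by norm_num, Bool, ⟨true⟩,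
    fun l => fam (if l then (1 / 8 : ℝ) else 0), ?_, ?_, ?_⟩
  · intro l
    obtain ⟨h0, h1⟩ := key l
    exact ⟨sker_pos _ _ (uphi_norm h0 h1), sker_pick _ _ (dphi_ne h0 h1) (uphi_norm h0 h1)⟩
  · intro l
    obtain ⟨h0, h1⟩ := key l
    exact ⟨_, h_pos (fun z : Disc (1 / 4) => phi (if l then (1 / 8 : ℝ) else 0) z)
      (fun z => (phi_norm h0 h1 z).trans (by norm_num)), fun z w => fam_bergman h0 h1 z w⟩
  · rintro ⟨s₀, h, hs, hp, hh, hb, hl⟩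
    obtain ⟨f, hf, hsf⟩ := hl false
    obtain ⟨g, hg, hsg⟩ := hl true
    exact no_cert s₀ h hs hp hh hb f g hf hg (by simpa using hsf) (by simpa using hsg)
end
end

section
/- Suppose k, ℓ, p are positive kernels on a nonempty set X, z₀ ∈ X, and: ℓ^{z₀} ⪰ p·ℓ, p·k ⪰ k^{z₀}, and p(x,x) < 1 for all x ∈ X. Then the function s(w,v) = (k(w,z₀)·k(z₀,v)/k(z₀,z₀))·(1 − p(w,v))^{−1} is a strong Shimorin certificate for (k, ℓ); that is, s is a complete Pick kernel on X and there exist positive kernels h and g on X with k(w,v) = (1 − h(w,v))·s(w,v) and ℓ(w,v) = s(w,v)·g(w,v) for all w, v ∈ X. -/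
open Matrix
open scoped ComplexOrder

noncomputable section

/-- The kernel `ℓ^z (w, v) = ℓ(w,v) − ℓ(w,z)·ℓ(z,v)/ℓ(z,z)` of the subspace of functions
vanishing at `z`. -/
def kerShift {X : Type*} (ℓ : X → X → ℂ) (z : X) (w v : X) : ℂ :=
  ℓ w v - ℓ w z * ℓ z v / ℓ z z

/-- A Shimorin certificate for `(k, ℓ)`: a family `p[z]` of positive kernels with
`ℓ^z ⪰ p[z]·ℓ` and `p[z]·k ⪰ k^z` for every `z`. -/
def IsShimorinCertificate {X : Type*} (k ℓ : X → X → ℂ) (p : X → X → X → ℂ) : Prop :=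
  ∀ z : X, IsPosKernel (p z) ∧
    IsPosKernel (fun w v => kerShift ℓ z w v - p z w v * ℓ w v) ∧
    IsPosKernel (fun w v => p z w v * k w v - kerShift k z w v)

/-- `s` is a strong Shimorin certificate for the pair `(k, ℓ)`: a complete Pick kernel with
`k = (1 − h)·s` and `ℓ = s·g` for some positive kernels `h`, `g`. -/
def IsStrongShimorinCertificate {X : Type*} (k ℓ s : X → X → ℂ) : Prop :=
  IsPosKernel s ∧ IsCompletePickPair s s ∧
    ∃ h g : X → X → ℂ, IsPosKernel h ∧ IsPosKernel g ∧
      (∀ z w, k z w = (1 - h z w) * s z w) ∧ (∀ z w, ℓ z w = s z w * g z w)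

open scoped InnerProductSpace
universe u

lemma kernel_conj {X : Type*} {k : X → X → ℂ} (hk : IsPosKernel k) (x y : X) :
    (starRingEnd ℂ) (k x y) = k y x := by
  have hx := hk 1 ![x] ![1]
  have hy := hk 1 ![y] ![1]
  have h1 := hk 2 ![x, y] ![1, 1]
  have h2 := hk 2 ![x, y] ![1, Complex.I]
  simp [Fin.sum_univ_two, Complex.le_def] at hx hy h1 h2
  apply Complex.ext
  · simp; linarith [h2.2]
  · simp; linarith [h1.2]

lemma kernel_psd {X : Type*} {k : X → X → ℂ} (hk : IsPosKernel k) {n : ℕ} (z : Fin n → X) :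
    (Matrix.of fun i j => k (z i) (z j)).PosSemidef := by
  refine Matrix.PosSemidef.of_dotProduct_mulVec_nonneg ?_ ?_
  · ext i j
    simp [Matrix.conjTranspose_apply, kernel_conj hk]
  · intro c
    refine (hk n z c).trans_eq ?_
    simp only [dotProduct, mulVec, Finset.mul_sum, Matrix.of_apply]
    refine Finset.sum_congr rfl fun i _ => Finset.sum_congr rfl fun j _ => ?_
    simp; ring

lemma psd_sum {n : ℕ} {M : Matrix (Fin n) (Fin n) ℂ} (h : M.PosSemidef) (c : Fin n → ℂ) :
    0 ≤ ∑ i, ∑ j, (starRingEnd ℂ) (c i) * c j * M i j := by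
  refine (h.dotProduct_mulVec_nonneg c).trans_eq ?_
  simp only [dotProduct, mulVec, Finset.mul_sum]
  refine Finset.sum_congr rfl fun i _ => Finset.sum_congr rfl fun j _ => ?_
  simp; ring

lemma kernel_mul {X : Type*} {k l : X → X → ℂ} (hk : IsPosKernel k) (hl : IsPosKernel l) :
    IsPosKernel (fun x y => k x y * l x y) := fun n z c =>
  psd_sum ((kernel_psd hk z).hadamard (kernel_psd hl z)) c

lemma kernel_add {X : Type*} {k l : X → X → ℂ} (hk : IsPosKernel k) (hl : IsPosKernel l) :
    IsPosKernel (fun x y => k x y + l x y) := fun n z c => by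
  refine (add_nonneg (hk n z c) (hl n z c)).trans_eq ?_
  simp only [mul_add, Finset.sum_add_distrib]

lemma kernel_rank1 {X : Type*} (f : X → ℂ) :
    IsPosKernel (fun x y => f x * (starRingEnd ℂ) (f y)) := fun n z c => by
  have : ∑ i, ∑ j, (starRingEnd ℂ) (c i) * c j * (f (z i) * (starRingEnd ℂ) (f (z j)))
      = (starRingEnd ℂ) (∑ i, c i * (starRingEnd ℂ) (f (z i))) *
        (∑ i, c i * (starRingEnd ℂ) (f (z i))) := by
    rw [map_sum, Finset.sum_mul_sum]
    refine Finset.sum_congr rfl fun i _ => Finset.sum_congr rfl fun j _ => ?_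
    simp; ring
  rw [this]
  exact star_mul_self_nonneg _

lemma kernel_gram {X : Type*} {H : Type*} [NormedAddCommGroup H] [InnerProductSpace ℂ H]
    (b : X → H) : IsPosKernel (fun x y => ⟪b x, b y⟫_ℂ) := fun n z c =>
  psd_sum (Matrix.posSemidef_gram ℂ (fun i => b (z i))) c

lemma kolmogorov {X : Type u} {k : X → X → ℂ} (hk : IsPosKernel k) :
    ∃ (H : Type u) (_ : NormedAddCommGroup H) (_ : InnerProductSpace ℂ H) (b : X → H),
      ∀ x y, ⟪b x, b y⟫_ℂ = k x y := by
  let K : Matrix X X (ℂ →L[ℂ] ℂ) := Matrix.of fun x y => k x y • ContinuousLinearMap.id ℂ ℂ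
  have hK : K.PosSemidef := by
    have := (RKHS.posSemidef_tfae (K := K)).out 0 2
    rw [this]
    constructor
    · ext x y
      have : star (k y x) = k x y := kernel_conj hk y x
      simp [K, Matrix.conjTranspose_apply, star_smul, this]
      have : star (ContinuousLinearMap.id ℂ ℂ) = ContinuousLinearMap.id ℂ ℂ := star_one _
      rw [this]; simp
    · intro f
      have h := hk f.support.card (fun i => (f.support.equivFin.symm i : X))
        (fun i => f (f.support.equivFin.symm i : X))
      have h2 : (f.sum fun x w ↦ f.sum fun x' w' ↦ ⟪K x' x w, w'⟫_ℂ) =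
        (starRingEnd ℂ) (∑ i, ∑ j, (starRingEnd ℂ) (f (f.support.equivFin.symm i : X)) * 
          f (f.support.equivFin.symm j : X) * 
          k (f.support.equivFin.symm i : X) (f.support.equivFin.symm j : X)) := by
        rw [Equiv.sum_comp f.support.equivFin.symm (fun i => ∑ j, (starRingEnd ℂ) (f i) * 
          f (f.support.equivFin.symm j : X) * k i (f.support.equivFin.symm j : X))]
        simp_rw [fun i : f.support => Equiv.sum_comp f.support.equivFin.symm (fun j => 
          (starRingEnd ℂ) (f i) * f j * k i j)]
        rw [Finset.sum_comm]
        simp only [Finsupp.sum, map_sum]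
        rw [← Finset.sum_coe_sort]
        refine Finset.sum_congr rfl fun i _ => ?_
        rw [← Finset.sum_coe_sort]
        refine Finset.sum_congr rfl fun j _ => ?_
        simp [K]; ring
      rw [h2]
      change 0 ≤ ((starRingEnd ℂ) _).re
      rw [Complex.conj_re]
      exact (Complex.le_def.1 h).1
  have : Fact K.PosSemidef := ⟨hK⟩
  refine ⟨RKHS.OfKernel K, inferInstance, inferInstance, fun x => RKHS.kerFun (RKHS.OfKernel K) x 1, ?_⟩
  intro x y
  rw [← RKHS.kernel_inner, RKHS.OfKernel.kernel_ofKernel]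
  simp [K, kernel_conj hk]

lemma kernel_abs_lt {X : Type*} {p : X → X → ℂ} (hp : IsPosKernel p) (hd : ∀ x, p x x < 1)
    (x y : X) : ‖p x y‖ < 1 := by
  obtain ⟨H, _, _, b, hb⟩ := kolmogorov hp
  have hn : ∀ x, ‖b x‖ < 1 := fun x => by
    have h := hd x
    rw [← hb, inner_self_eq_norm_sq_to_K] at h
    have h' : ‖b x‖ ^ 2 < 1 := by
      have h3 := (Complex.lt_def.1 h).1
      rw [← Complex.ofReal_one] at h3
      simpa [← Complex.ofReal_pow] using h3
    nlinarith [norm_nonneg (b x)]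
  rw [← hb]
  calc _ ≤ ‖b x‖ * ‖b y‖ := norm_inner_le_norm _ _
    _ < 1 := by nlinarith [norm_nonneg (b x), norm_nonneg (b y), hn x, hn y]

lemma kernel_geom {X : Type*} {p : X → X → ℂ} (hp : IsPosKernel p) (hd : ∀ x, p x x < 1) :
    IsPosKernel (fun x y => (1 - p x y)⁻¹) := by
  have hpow : ∀ m : ℕ, IsPosKernel (fun x y => p x y ^ m) := by
    intro m
    induction m with
    | zero => simpa using kernel_rank1 (fun _ : X => (1 : ℂ))
    | succ m ih => simpa [pow_succ] using kernel_mul ih hp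
  intro n z c
  have hs : HasSum (fun m => ∑ i, ∑ j, (starRingEnd ℂ) (c i) * c j * p (z i) (z j) ^ m)
      (∑ i, ∑ j, (starRingEnd ℂ) (c i) * c j * (1 - p (z i) (z j))⁻¹) := by
    refine hasSum_sum fun i _ => hasSum_sum fun j _ => ?_
    exact (hasSum_geometric_of_norm_lt_one (kernel_abs_lt hp hd _ _)).mul_left _
  exact hs.nonneg fun m => hpow m n z c

lemma contraction_ext {U P Q : Type*} [AddCommGroup U] [Module ℂ U] [FiniteDimensional ℂ U]
    [NormedAddCommGroup P] [InnerProductSpace ℂ P] [NormedAddCommGroup Q] [InnerProductSpace ℂ Q]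
    (f : U →ₗ[ℂ] P) (g : U →ₗ[ℂ] Q) (h : ∀ u, ‖g u‖ = ‖f u‖) :
    ∃ T : P →ₗ[ℂ] Q, (∀ x, ‖T x‖ ≤ ‖x‖) ∧ ∀ u, T (f u) = g u := by
  obtain ⟨r, hr⟩ := f.rangeRestrict.exists_rightInverse_of_surjective f.range_rangeRestrict
  have hr' : ∀ y : LinearMap.range f, f (r y) = y := fun y => by
    have := congrArg Subtype.val (LinearMap.congr_fun hr y)
    simpa using this
  refine ⟨g ∘ₗ r ∘ₗ (LinearMap.range f).orthogonalProjectionOnto.toLinearMap, ?_, ?_⟩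
  · intro x
    simp only [LinearMap.comp_apply, h, hr']
    exact Submodule.norm_orthogonalProjectionOnto_apply_le _ _
  · intro u
    have : (LinearMap.range f).orthogonalProjectionOnto (f u) = ⟨f u, ⟨u, rfl⟩⟩ :=
      Submodule.orthogonalProjectionOnto_mem_subspace_eq_self (K := LinearMap.range f) ⟨f u, ⟨u, rfl⟩⟩
    simp only [LinearMap.comp_apply, ContinuousLinearMap.coe_coe, this]
    rw [← sub_eq_zero, ← map_sub, ← norm_eq_zero, h, map_sub, hr']
    simp

/-- amplification of a vector -/
def ampl {ι H : Type*} [Fintype ι] [NormedAddCommGroup H] [InnerProductSpace ℂ H] (b : H) :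
    EuclideanSpace ℂ ι →ₗ[ℂ] PiLp 2 (fun _ : ι => H) where
  toFun f := WithLp.toLp 2 (fun a => f a • b)
  map_add' f g := by ext a; simp [add_smul]
  map_smul' c f := by ext a; simp [mul_smul]

lemma ampl_inner {ι H : Type*} [Fintype ι] [NormedAddCommGroup H] [InnerProductSpace ℂ H]
    (b c : H) (f g : EuclideanSpace ℂ ι) :
    ⟪ampl b f, ampl c g⟫_ℂ = ⟪b, c⟫_ℂ * ⟪f, g⟫_ℂ := by
  simp only [PiLp.inner_apply, ampl, LinearMap.coe_mk, AddHom.coe_mk, inner_smul_left,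
    inner_smul_right, Finset.mul_sum, RCLike.inner_apply]
  refine Finset.sum_congr rfl fun a _ => ?_
  ring

lemma ampl_norm {ι H : Type*} [Fintype ι] [NormedAddCommGroup H] [InnerProductSpace ℂ H]
    (b : H) (f : EuclideanSpace ℂ ι) : ‖ampl b f‖ = ‖b‖ * ‖f‖ := by
  have h := ampl_inner b b f f
  simp only [inner_self_eq_norm_sq_to_K] at h
  have h2 : ‖ampl b f‖ ^ 2 = ‖b‖ ^ 2 * ‖f‖ ^ 2 := by
    apply Complex.ofReal_injective
    push_cast
    exact h
  rw [← mul_pow] at h2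
  exact (sq_eq_sq₀ (norm_nonneg _) (by positivity)).1 h2

lemma solve {E F : Type*} [AddCommGroup E] [Module ℂ E] [NormedAddCommGroup F]
    [InnerProductSpace ℂ F] [FiniteDimensional ℂ F] (A : F →ₗ[ℂ] F) (C : E →ₗ[ℂ] F)
    (r : ℝ) (hr : r < 1) (hA : ∀ f, ‖A f‖ ≤ r * ‖f‖) :
    ∃ γ : E →ₗ[ℂ] F, (∀ u, γ u = A (γ u) + C u) ∧ ∀ u f, f = A f + C u → f = γ u := by
  have hfix : ∀ f, f = A f → f = 0 := fun f hf => by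
    have h := hA f
    rw [← hf] at h
    have := norm_nonneg f
    exact norm_eq_zero.1 (by nlinarith)
  have hinj : Function.Injective ((LinearMap.id - A : F →ₗ[ℂ] F)) := by
    refine (injective_iff_map_eq_zero _).2 fun f hf => ?_
    exact hfix f (sub_eq_zero.1 hf)
  let e := LinearEquiv.ofInjectiveEndo _ hinj
  have he : ∀ f, e f = f - A f := fun f => rfl
  have h1 : ∀ u, e.symm (C u) = A (e.symm (C u)) + C u := fun u => by
    have := e.apply_symm_apply (C u)
    rw [he] at this
    rw [← sub_eq_iff_eq_add', this]
  refine ⟨e.symm.toLinearMap ∘ₗ C, h1, ?_⟩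
  intro u f hf
  rw [LinearMap.comp_apply, LinearEquiv.coe_coe, LinearEquiv.eq_symm_apply, he, sub_eq_iff_eq_add']
  exact hf

lemma lurking {X E F K : Type*} [NormedAddCommGroup E] [InnerProductSpace ℂ E]
    [FiniteDimensional ℂ E] [NormedAddCommGroup F] [InnerProductSpace ℂ F]
    [FiniteDimensional ℂ F] [NormedAddCommGroup K] [InnerProductSpace ℂ K]
    (p : X → X → ℂ) (β : X → F →ₗ[ℂ] K) (r : X → ℝ) (hr : ∀ x, r x < 1)
    (hβ : ∀ x y f g, ⟪β x f, β y g⟫_ℂ = p x y * ⟪f, g⟫_ℂ)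
    (hβn : ∀ x f, ‖β x f‖ = r x * ‖f‖) {n : ℕ} (z : Fin n → X)
    (ω : Fin n → E →ₗ[ℂ] E) (γ : Fin n → E →ₗ[ℂ] F)
    (hid : ∀ i j u v, ⟪u, v⟫_ℂ + p (z i) (z j) * ⟪γ i u, γ j v⟫_ℂ
      = ⟪ω i u, ω j v⟫_ℂ + ⟪γ i u, γ j v⟫_ℂ) :
    ∃ (φ : X → E →ₗ[ℂ] E) (γ' : X → E →ₗ[ℂ] F),
      (∀ i, φ (z i) = ω i) ∧
      IsPosKernel (fun a c : X × E => ⟪a.2, c.2⟫_ℂ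
        + p a.1 c.1 * ⟪γ' a.1 a.2, γ' c.1 c.2⟫_ℂ
        - ⟪φ a.1 a.2, φ c.1 c.2⟫_ℂ - ⟪γ' a.1 a.2, γ' c.1 c.2⟫_ℂ) := by
  classical
  let toP : (E × K) →ₗ[ℂ] WithLp 2 (E × K) := (WithLp.linearEquiv 2 ℂ (E × K)).symm.toLinearMap
  let toQ : (E × F) →ₗ[ℂ] WithLp 2 (E × F) := (WithLp.linearEquiv 2 ℂ (E × F)).symm.toLinearMap
  let ofQ : WithLp 2 (E × F) →ₗ[ℂ] (E × F) := (WithLp.linearEquiv 2 ℂ (E × F)).toLinearMap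
  have iP : ∀ x y : E × K, ⟪toP x, toP y⟫_ℂ = ⟪x.1, y.1⟫_ℂ + ⟪x.2, y.2⟫_ℂ := fun x y => rfl
  have iQ : ∀ x y : E × F, ⟪toQ x, toQ y⟫_ℂ = ⟪x.1, y.1⟫_ℂ + ⟪x.2, y.2⟫_ℂ := fun x y => rfl
  have hQ : ∀ x, toQ (ofQ x) = x := fun x => rfl
  have hQ' : ∀ x, ofQ (toQ x) = x := fun x => rfl
  -- the two maps
  let fi : Fin n → E →ₗ[ℂ] WithLp 2 (E × K) := fun i =>
    toP ∘ₗ (LinearMap.prod LinearMap.id (β (z i) ∘ₗ γ i))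
  let gi : Fin n → E →ₗ[ℂ] WithLp 2 (E × F) := fun i =>
    toQ ∘ₗ (LinearMap.prod (ω i) (γ i))
  let f : (Fin n → E) →ₗ[ℂ] WithLp 2 (E × K) := ∑ i, fi i ∘ₗ LinearMap.proj i
  let g : (Fin n → E) →ₗ[ℂ] WithLp 2 (E × F) := ∑ i, gi i ∘ₗ LinearMap.proj i
  have hfg : ∀ i j u v, ⟪gi i u, gi j v⟫_ℂ = ⟪fi i u, fi j v⟫_ℂ := by
    intro i j u v
    simp only [fi, gi, LinearMap.comp_apply, iP, iQ, LinearMap.prod_apply, Function.prod,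
      LinearMap.id_apply, hβ]
    exact (hid i j u v).symm
  have hnorm : ∀ u, ‖g u‖ = ‖f u‖ := by
    intro u
    have : ⟪g u, g u⟫_ℂ = ⟪f u, f u⟫_ℂ := by
      simp only [f, g, LinearMap.sum_apply, LinearMap.comp_apply, LinearMap.proj_apply,
        sum_inner, inner_sum, hfg]
    rw [@norm_eq_sqrt_re_inner ℂ, @norm_eq_sqrt_re_inner ℂ _ _ _ _ (f u), this]
  obtain ⟨T, hT, hTf⟩ := contraction_ext f g hnorm
  have hTi : ∀ i u, T (fi i u) = gi i u := by
    intro i u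
    have h := hTf (Pi.single i u)
    have e1 : f (Pi.single i u) = fi i u := by
      simp only [f, LinearMap.sum_apply, LinearMap.comp_apply, LinearMap.proj_apply]
      rw [Finset.sum_eq_single i] <;> simp +contextual [Pi.single_apply]
    have e2 : g (Pi.single i u) = gi i u := by
      simp only [g, LinearMap.sum_apply, LinearMap.comp_apply, LinearMap.proj_apply]
      rw [Finset.sum_eq_single i] <;> simp +contextual [Pi.single_apply]
    rw [← e1, h, e2]
  let C : E →ₗ[ℂ] F := LinearMap.snd ℂ E F ∘ₗ ofQ ∘ₗ T ∘ₗ toP ∘ₗ LinearMap.inl ℂ E K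
  let A : X → F →ₗ[ℂ] F := fun x =>
    LinearMap.snd ℂ E F ∘ₗ ofQ ∘ₗ T ∘ₗ toP ∘ₗ LinearMap.inr ℂ E K ∘ₗ β x
  have hA : ∀ x f, ‖A x f‖ ≤ r x * ‖f‖ := by
    intro x f
    rw [← hβn]
    calc ‖A x f‖ ≤ ‖T (toP (0, β x f))‖ := WithLp.norm_snd_le _ _
      _ ≤ ‖toP (0, β x f)‖ := hT _
      _ = ‖β x f‖ := WithLp.norm_toLp_snd 2 E K _
  choose γ' hγ1 hγ2 using fun x => solve (A x) C (r x) (hr x) (hA x)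
  let L : X → E →ₗ[ℂ] WithLp 2 (E × K) := fun x =>
    toP ∘ₗ (LinearMap.prod LinearMap.id (β x ∘ₗ γ' x))
  let φ : X → E →ₗ[ℂ] E := fun x => LinearMap.fst ℂ E F ∘ₗ ofQ ∘ₗ T ∘ₗ L x
  have hsplit : ∀ x u (h : F), (ofQ (T (toP (u, β x h)))).2 = A x h + C u := by
    intro x u h
    have : toP (u, β x h) = toP (0, β x h) + toP (u, 0) := by
      rw [← map_add]; simp
    rw [this, map_add, map_add]
    rfl
  have hTL : ∀ x u, T (L x u) = toQ (φ x u, γ' x u) := by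
    intro x u
    rw [← hQ (T (L x u))]
    congr 1
    refine Prod.ext rfl ?_
    rw [show γ' x u = _ from hγ1 x u]
    exact hsplit x u _
  have hγz : ∀ i u, γ' (z i) u = γ i u := by
    intro i u
    symm
    apply hγ2
    rw [← hsplit]
    have := hTi i u
    have h2 := congrArg (fun q => (ofQ q).2) this
    exact h2.symm
  refine ⟨φ, γ', ?_, ?_⟩
  · intro i
    ext u
    have h2 := congrArg (fun q => (ofQ q).1) (hTi i u)
    have : L (z i) u = fi i u := by
      simp only [L, fi, LinearMap.comp_apply, LinearMap.prod_apply, Function.prod, hγz]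
    change (ofQ (T (L (z i) u))).1 = _
    rw [this]
    exact h2
  · intro m y c
    let v : WithLp 2 (E × K) := ∑ i, c i • L (y i).1 (y i).2
    have key : ∑ i, ∑ j, (starRingEnd ℂ) (c i) * c j * (⟪(y i).2, (y j).2⟫_ℂ
        + p (y i).1 (y j).1 * ⟪γ' (y i).1 (y i).2, γ' (y j).1 (y j).2⟫_ℂ
        - ⟪φ (y i).1 (y i).2, φ (y j).1 (y j).2⟫_ℂ - ⟪γ' (y i).1 (y i).2, γ' (y j).1 (y j).2⟫_ℂ)
        = ⟪v, v⟫_ℂ - ⟪T v, T v⟫_ℂ := by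
      simp only [v, map_sum, map_smul, sum_inner, inner_sum, inner_smul_left, inner_smul_right,
        hTL, Finset.mul_sum, ← Finset.sum_sub_distrib]
      rw [Finset.sum_comm]
      refine Finset.sum_congr rfl fun i _ => Finset.sum_congr rfl fun j _ => ?_
      simp only [L, iQ, iP, LinearMap.comp_apply, LinearMap.prod_apply, Function.prod, hβ,
        LinearMap.id_apply]
      ring
    rw [key]
    simp only [inner_self_eq_norm_sq_to_K]
    have h := pow_le_pow_left₀ (norm_nonneg _) (hT v) 2
    rw [sub_nonneg]
    have h3 : ((‖T v‖ ^ 2 : ℝ) : ℂ) ≤ ((‖v‖ ^ 2 : ℝ) : ℂ) := by exact_mod_cast h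
    push_cast at h3
    exact h3

lemma kernel_comp {X Y : Type*} {k : X → X → ℂ} (hk : IsPosKernel k) (f : Y → X) :
    IsPosKernel (fun a c => k (f a) (f c)) := fun n z c => hk n (fun i => f (z i)) c

open scoped MatrixOrder Matrix.Norms.L2Operator in
lemma psd_factor {m : Type*} [Fintype m] [DecidableEq m] {G : Matrix m m ℂ} (hG : G.PosSemidef) :
    ∃ B : Matrix m m ℂ, G = Bᴴ * B :=
  CStarAlgebra.nonneg_iff_eq_star_mul_self.mp hG.nonneg

lemma pick_entry {N : ℕ} (a c : ℂ) (W V : Matrix (Fin N) (Fin N) ℂ) (u v : Fin N → ℂ) :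
    star u ⬝ᵥ ((a • (1 : Matrix (Fin N) (Fin N) ℂ) - c • (W * Vᴴ)) *ᵥ v)
      = a * ⟪WithLp.toLp 2 u, WithLp.toLp 2 v⟫_ℂ
        - c * ⟪Matrix.toEuclideanLin Wᴴ (WithLp.toLp 2 u),
            Matrix.toEuclideanLin Vᴴ (WithLp.toLp 2 v)⟫_ℂ := by
  have h1 : star u ⬝ᵥ ((W * Vᴴ) *ᵥ v) = star (Wᴴ *ᵥ u) ⬝ᵥ (Vᴴ *ᵥ v) := by
    rw [star_mulVec, conjTranspose_conjTranspose, ← mulVec_mulVec, dotProduct_mulVec]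
  rw [sub_mulVec, dotProduct_sub, smul_mulVec, smul_mulVec, dotProduct_smul, dotProduct_smul,
    one_mulVec, h1]
  simp only [EuclideanSpace.inner_eq_star_dotProduct, Matrix.toLpLin_toLp, smul_eq_mul]
  congr 2 <;> exact dotProduct_comm _ _

lemma inner_lin {N M : Type*} [Fintype N] [Fintype M] [DecidableEq N] (A B : Matrix M N ℂ)
    (u v : EuclideanSpace ℂ N) :
    ⟪Matrix.toEuclideanLin A u, Matrix.toEuclideanLin B v⟫_ℂ
      = star u.ofLp ⬝ᵥ ((Aᴴ * B) *ᵥ v.ofLp) := by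
  rw [EuclideanSpace.inner_eq_star_dotProduct, ← mulVec_mulVec, dotProduct_mulVec, 
    ← star_mulVec, dotProduct_comm]
  rfl

lemma pick_scale {X : Type*} {k ℓ : X → X → ℂ} (δ : X → ℂ) {n N : ℕ}
    {z : Fin n → X} {W : Fin n → Matrix (Fin N) (Fin N) ℂ} (h : PickBlockPSD k ℓ z W) :
    PickBlockPSD (fun w v => δ w * (starRingEnd ℂ) (δ v) * k w v)
      (fun w v => δ w * (starRingEnd ℂ) (δ v) * ℓ w v) z W := by
  intro u
  refine (h (fun i => (starRingEnd ℂ) (δ (z i)) • u i)).trans_eq ?_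
  refine Finset.sum_congr rfl fun i _ => Finset.sum_congr rfl fun j _ => ?_
  simp only [pick_entry, WithLp.toLp_smul, map_smul, inner_smul_left, inner_smul_right,
    Complex.conj_conj]
  ring

lemma pick_core {X : Type*} {p : X → X → ℂ} (hp : IsPosKernel p) (hd : ∀ x, p x x < 1) :
    IsCompletePickPair (fun w v => (1 - p w v)⁻¹) (fun w v => (1 - p w v)⁻¹) := by
  intro n N _ _ z W hW
  have hne : ∀ x y, 1 - p x y ≠ 0 := fun x y h => by
    have h1 := kernel_abs_lt hp hd x y
    rw [← sub_eq_zero.1 h] at h1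
    simp at h1
  obtain ⟨H, _, _, b, hb⟩ := kolmogorov hp
  have hn : ∀ x, ‖b x‖ < 1 := fun x => by
    have h := hd x
    rw [← hb, inner_self_eq_norm_sq_to_K] at h
    have h' : ‖b x‖ ^ 2 < 1 := by
      have h3 := (Complex.lt_def.1 h).1
      rw [← Complex.ofReal_one] at h3
      simpa [← Complex.ofReal_pow] using h3
    nlinarith [norm_nonneg (b x)]
  have hT := kernel_geom hp hd
  let G : Matrix (Fin n × Fin N) (Fin n × Fin N) ℂ := Matrix.of fun q r =>
    ((1 - p (z q.1) (z r.1))⁻¹ • (1 : Matrix (Fin N) (Fin N) ℂ)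
        - (1 - p (z q.1) (z r.1))⁻¹ • (W q.1 * (W r.1)ᴴ)) q.2 r.2
  have hG : G.PosSemidef := by
    refine Matrix.PosSemidef.of_dotProduct_mulVec_nonneg ?_ ?_
    · ext ⟨i, a⟩ ⟨j, c⟩
      have h1 : star ((1 - p (z j) (z i))⁻¹) = (1 - p (z i) (z j))⁻¹ :=
        kernel_conj hT (z j) (z i)
      have h2 : ((1 - p (z j) (z i))⁻¹ • (1 : Matrix (Fin N) (Fin N) ℂ)
        - (1 - p (z j) (z i))⁻¹ • (W j * (W i)ᴴ))ᴴ = ((1 - p (z i) (z j))⁻¹ •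
          (1 : Matrix (Fin N) (Fin N) ℂ) - (1 - p (z i) (z j))⁻¹ • (W i * (W j)ᴴ)) := by
        rw [conjTranspose_sub, conjTranspose_smul, conjTranspose_smul, h1, conjTranspose_mul,
          conjTranspose_conjTranspose, conjTranspose_one]
      exact congrFun (congrFun h2 a) c
    · intro x
      refine (hW fun i a => x (i, a)).trans_eq ?_
      simp only [dotProduct, mulVec, Fintype.sum_prod_type, Finset.mul_sum, G, Matrix.of_apply]
      refine Finset.sum_congr rfl fun i _ => ?_
      rw [Finset.sum_comm]
      rfl
  obtain ⟨B, hB⟩ := psd_factor hG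
  let Bi : Fin n → Matrix (Fin n × Fin N) (Fin N) ℂ := fun i => B.submatrix id (fun a => (i, a))
  have hBi : ∀ i j, (Bi i)ᴴ * Bi j = ((1 - p (z i) (z j))⁻¹ •
          (1 : Matrix (Fin N) (Fin N) ℂ) - (1 - p (z i) (z j))⁻¹ • (W i * (W j)ᴴ)) := by
    intro i j
    ext a c
    exact (congrFun (congrFun hB (i, a)) (j, c)).symm
  obtain ⟨φ, γ', hφ, hpos⟩ := lurking p
    (fun x => ampl (ι := Fin n × Fin N) (b x)) (fun x => ‖b x‖) hn
    (fun x y f g => by rw [ampl_inner, hb]) (fun x f => ampl_norm _ _) z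
    (fun i => Matrix.toEuclideanLin (W i)ᴴ) (fun i => Matrix.toEuclideanLin (Bi i)) (by
      intro i j u v
      have h1 := inner_lin (Bi i) (Bi j) u v
      rw [hBi, pick_entry] at h1
      rw [h1]
      have := hne (z i) (z j)
      field_simp
      simp only [WithLp.toLp_ofLp]
      ring)
  refine ⟨fun x => (Matrix.toEuclideanLin.symm (φ x))ᴴ, ?_, ?_⟩
  · intro m x u
    have h1 := kernel_comp hT x
    have h2 := kernel_gram (fun i : Fin m => γ' (x i) (WithLp.toLp 2 (u i)))
    have h3 := kernel_comp hpos (fun i : Fin m => (x i, WithLp.toLp 2 (u i)))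
    have h4 := kernel_add (kernel_mul h1 h3) h2 m id (fun _ => 1)
    refine h4.trans_eq ?_
    refine Finset.sum_congr rfl fun i _ => Finset.sum_congr rfl fun j _ => ?_
    rw [pick_entry]
    simp only [conjTranspose_conjTranspose, LinearEquiv.apply_symm_apply, id, map_one]
    have := hne (x i) (x j)
    field_simp
    ring
  · intro i
    simp [hφ]

theorem pick_main {X : Type*} {p : X → X → ℂ} (hp : IsPosKernel p) (hd : ∀ x, p x x < 1)
    (δ : X → ℂ) (hδ : ∀ x, δ x ≠ 0) :
    IsCompletePickPair (fun w v => δ w * (starRingEnd ℂ) (δ v) * (1 - p w v)⁻¹)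
      (fun w v => δ w * (starRingEnd ℂ) (δ v) * (1 - p w v)⁻¹) := by
  intro n N hn hN z W hW
  have h := pick_scale (fun x => (δ x)⁻¹) hW
  have e : (fun w v => (δ w)⁻¹ * (starRingEnd ℂ) ((δ v)⁻¹) * 
      (δ w * (starRingEnd ℂ) (δ v) * (1 - p w v)⁻¹)) = fun w v => (1 - p w v)⁻¹ := by
    funext w v
    have h1 := hδ w
    have h2 : (starRingEnd ℂ) (δ v) ≠ 0 := by simpa using hδ v
    rw [map_inv₀]
    field_simp
  rw [e] at h
  obtain ⟨Φ, h1, h2⟩ := pick_core hp hd n N hn hN z W h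
  exact ⟨Φ, fun m x => pick_scale δ (h1 m x), h2⟩

lemma exists_root {a : ℂ} (ha : 0 < a) : ∃ r : ℂ, r ≠ 0 ∧ r * (starRingEnd ℂ) r = a := by
  have h := Complex.lt_def.1 ha
  refine ⟨(Real.sqrt a.re : ℂ), ?_, ?_⟩
  · simpa using (Real.sqrt_pos.2 h.1).ne'
  · rw [Complex.conj_ofReal, ← Complex.ofReal_mul, Real.mul_self_sqrt h.1.le]
    exact Complex.ext rfl (by simpa using h.2)

/-- If `ℓ^{z₀} ⪰ p·ℓ`, `p·k ⪰ k^{z₀}` and `p(x,x) < 1` for all `x`, then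
`s(w,v) = (k(w,z₀)k(z₀,v)/k(z₀,z₀))·(1 − p(w,v))⁻¹` is a strong Shimorin certificate
for `(k, ℓ)`. -/
theorem single_point_certificate {X : Type*} [Nonempty X] (k ℓ p : X → X → ℂ)
    (hk : IsPosKernel k) (hℓ : IsPosKernel ℓ) (hp : IsPosKernel p)
    (hkd : ∀ x, 0 < k x x) (hℓd : ∀ x, 0 < ℓ x x)
    (z₀ : X)
    (h₁ : IsPosKernel (fun w v => kerShift ℓ z₀ w v - p w v * ℓ w v))
    (h₂ : IsPosKernel (fun w v => p w v * k w v - kerShift k z₀ w v))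
    (hdiag : ∀ x, p x x < 1) :
    IsStrongShimorinCertificate k ℓ
      (fun w v => k w z₀ * k z₀ v / k z₀ z₀ * (1 - p w v)⁻¹) := by
  have h00 : k z₀ z₀ ≠ 0 := (hkd z₀).ne'
  have hk0 : ∀ x, k x z₀ ≠ 0 := by
    intro x hx
    have h := h₂ 1 ![x] ![1]
    have hd := (Complex.lt_def.1 (hdiag x)).1
    have hk1 := Complex.lt_def.1 (hkd x)
    simp [kerShift, hx, Complex.le_def] at h hd hk1
    have h2 : (k x x).im = 0 := hk1.2.symm
    rw [h2] at h
    nlinarith [h.1, hk1.1]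
  obtain ⟨r, hr0, hr⟩ : ∃ r : ℂ, r ≠ 0 ∧ r * (starRingEnd ℂ) r = k z₀ z₀ := by
    exact exists_root (hkd z₀)
  have hr1 : (starRingEnd ℂ) r ≠ 0 := by simpa using hr0
  have hs : (fun w v => k w z₀ * k z₀ v / k z₀ z₀ * (1 - p w v)⁻¹) =
      fun w v => (k w z₀ / r) * (starRingEnd ℂ) (k v z₀ / r) * (1 - p w v)⁻¹ := by
    funext w v
    rw [map_div₀, kernel_conj hk, ← hr]
    field_simp
  have hne : ∀ x y, 1 - p x y ≠ 0 := fun x y h => by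
    have h1 := kernel_abs_lt hp hdiag x y
    rw [← sub_eq_zero.1 h] at h1
    simp at h1
  have hk0' : ∀ x, k z₀ x ≠ 0 := fun x => by
    rw [← kernel_conj hk]; simpa using hk0 x
  have hinv := kernel_rank1 (fun x => r / k x z₀)
  have hℓ00 : ℓ z₀ z₀ ≠ 0 := (hℓd z₀).ne'
  have hl1 : IsPosKernel (fun w v => ℓ w z₀ * ℓ z₀ v / ℓ z₀ z₀) := by
    obtain ⟨q, hq0, hq⟩ := exists_root (hℓd z₀)
    have hq1 : (starRingEnd ℂ) q ≠ 0 := by simpa using hq0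
    convert kernel_rank1 (fun x => ℓ x z₀ / q) using 3 with w v
    rw [map_div₀, kernel_conj hℓ, ← hq]
    field_simp
  refine ⟨?_, ?_, fun w v => (r / k w z₀) * (starRingEnd ℂ) (r / k v z₀) *
      (p w v * k w v - kerShift k z₀ w v),
    fun w v => (r / k w z₀) * (starRingEnd ℂ) (r / k v z₀) *
      ((kerShift ℓ z₀ w v - p w v * ℓ w v) + ℓ w z₀ * ℓ z₀ v / ℓ z₀ z₀),
    kernel_mul hinv h₂, kernel_mul hinv (kernel_add h₁ hl1), ?_, ?_⟩
  · rw [hs]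
    exact kernel_mul (kernel_rank1 _) (kernel_geom hp hdiag)
  · rw [hs]
    exact pick_main hp hdiag _ fun x => div_ne_zero (hk0 x) hr0
  · intro w v
    have h1 := hk0 w
    have h2 := hk0' v
    have h3 := hne w v
    beta_reduce
    rw [map_div₀, kernel_conj hk]
    simp only [kerShift, ← hr]
    field_simp
    ring
  · intro w v
    have h1 := hk0 w
    have h2 := hk0' v
    have h3 := hne w v
    beta_reduce
    rw [map_div₀, kernel_conj hk]
    simp only [kerShift, ← hr]
    field_simp
    ring
end
end

section
/- Let k, ℓ be positive kernels on a nonempty set X and assume ℓ is non-vanishing, i.e. ℓ(z,w) ≠ 0 for all z, w ∈ X. Then the following are equivalent: (a) (k, ℓ) has a Shimorin certificate; (b) (k, ℓ) has a strong Shimorin certificate; (c) there exist a positive kernel p on X and a point z₀ ∈ X such that ℓ^{z₀} ⪰ p·ℓ and p·k ⪰ k^{z₀}. -/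
open Matrix
open scoped ComplexOrder

noncomputable section

open scoped InnerProductSpace TensorProduct

section API
universe u v
variable {X : Type u}

lemma posk_of_feature {H : Type v} [NormedAddCommGroup H] [InnerProductSpace ℂ H] (b : X → H) :
    IsPosKernel (fun x y => ⟪b x, b y⟫_ℂ) := by
  intro n z c
  have : ∑ i, ∑ j, (starRingEnd ℂ) (c i) * c j * ⟪b (z i), b (z j)⟫_ℂ
      = ⟪∑ i, c i • b (z i), ∑ j, c j • b (z j)⟫_ℂ := by
    rw [sum_inner]
    refine Finset.sum_congr rfl fun i _ => ?_
    rw [inner_sum]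
    refine Finset.sum_congr rfl fun j _ => ?_
    rw [inner_smul_left, inner_smul_right]
    ring
  rw [this]
  rw [← inner_self_ofReal_re]
  exact Complex.zero_le_real.mpr (inner_self_nonneg (𝕜 := ℂ) (x := ∑ i, c i • b (z i)))

lemma posk_sum {k : X → X → ℂ} (hk : IsPosKernel k) {ι : Type v} [Fintype ι] (z : ι → X)
    (c : ι → ℂ) : 0 ≤ ∑ i, ∑ j, (starRingEnd ℂ) (c i) * c j * k (z i) (z j) := by
  have e := (Fintype.equivFin ι).symm
  have := hk _ (z ∘ e) (c ∘ e)
  simp only [Function.comp] at this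
  rw [← e.sum_comp]
  simp_rw [← e.sum_comp (fun j => (starRingEnd ℂ) (c _) * c j * k (z _) (z j))]
  exact this

lemma posk_of_fintype {ι : Type v} [Fintype ι] [DecidableEq ι] {k : ι → ι → ℂ}
    (h : ∀ c : ι → ℂ, 0 ≤ ∑ i, ∑ j, (starRingEnd ℂ) (c i) * c j * k i j) : IsPosKernel k := by
  intro n z c
  have key : ∀ (d : Fin n → ℂ) (f : ι → ℂ),
      ∑ i, (∑ m, if z m = i then d m else 0) * f i = ∑ m, d m * f (z m) := by
    intro d f
    simp only [Finset.sum_mul]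
    rw [Finset.sum_comm]
    simp
  have h1 := h (fun i => ∑ m, if z m = i then c m else 0)
  have h2 : ∀ i, (starRingEnd ℂ) (∑ m, if z m = i then c m else 0)
      = ∑ m, if z m = i then (starRingEnd ℂ) (c m) else 0 := by
    intro i
    rw [map_sum]
    exact Finset.sum_congr rfl fun m _ => by split_ifs <;> simp
  simp only [mul_assoc, ← Finset.mul_sum] at h1 ⊢
  simp only [h2, key] at h1
  exact h1

lemma posk_herm {k : X → X → ℂ} (hk : IsPosKernel k) (x y : X) :
    (starRingEnd ℂ) (k x y) = k y x := by
  have h0 := fun a => hk 1 (fun _ => a) (fun _ => 1)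
  have h1 := hk 2 ![x, y] ![1, 1]
  have h2 := hk 2 ![x, y] ![1, Complex.I]
  have hx := h0 x
  have hy := h0 y
  simp [Fin.sum_univ_two, Complex.le_def] at h1 h2 hx hy
  apply Complex.ext <;> simp <;> linarith

lemma posk_feature {k : X → X → ℂ} (hk : IsPosKernel k) :
    ∃ (H : Type u) (_ : NormedAddCommGroup H) (_ : InnerProductSpace ℂ H) (_ : CompleteSpace H)
      (b : X → H), ∀ x y, k x y = ⟪b x, b y⟫_ℂ := by
  let K : Matrix X X (ℂ →L[ℂ] ℂ) := Matrix.of fun x y => k x y • ContinuousLinearMap.id ℂ ℂ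
  have hK : K.PosSemidef := by
    have T := (RKHS.posSemidef_tfae (K := K)).out 0 2
    refine T.mpr ⟨?_, ?_⟩
    · ext x y
      simp [K, ContinuousLinearMap.star_eq_adjoint, posk_herm hk, ContinuousLinearMap.adjoint_id]
    · intro vv
      have := posk_sum hk (ι := vv.support) (fun i => i.1) (fun i => vv i.1)
      have h2 := (Complex.le_def.mp this).1
      simp only [Finsupp.sum]
      rw [Finset.sum_coe_sort vv.support (fun i => ∑ j : vv.support, (starRingEnd ℂ) (vv i) * vv j * k i j)] at h2
      have h3 : ∀ i, ∑ j : vv.support, (starRingEnd ℂ) (vv i) * vv j * k i j = ∑ j ∈ vv.support, (starRingEnd ℂ) (vv i) * vv j * k i j := fun i => Finset.sum_coe_sort vv.support (fun j => (starRingEnd ℂ) (vv i) * vv j * k i j)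
      simp only [h3] at h2
      rw [Finset.sum_comm] at h2
      refine h2.trans (le_of_eq ?_)
      rw [RCLike.re_eq_complex_re, Finset.sum_comm]
      congr 1
      refine Finset.sum_congr rfl fun i _ => Finset.sum_congr rfl fun j _ => ?_
      simp [K, posk_herm hk]
      ring
  have : Fact K.PosSemidef := ⟨hK⟩
  refine ⟨RKHS.OfKernel K, inferInstance, inferInstance, inferInstance,
    fun x => RKHS.kerFun (RKHS.OfKernel K) x 1, fun x y => ?_⟩
  rw [← RKHS.kernel_inner, RKHS.OfKernel.kernel_ofKernel]
  simp [K, posk_herm hk]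

lemma posk_congr {k k' : X → X → ℂ} (hk : IsPosKernel k) (h : ∀ x y, k' x y = k x y) :
    IsPosKernel k' := by
  have : k' = k := by
    funext x y
    exact h x y
  rw [this]
  exact hk

lemma posk_comp {Y : Type v} {k : X → X → ℂ} (hk : IsPosKernel k) (f : Y → X) :
    IsPosKernel (fun x y => k (f x) (f y)) := fun n z c => hk n (fun i => f (z i)) c

lemma posk_add {k l : X → X → ℂ} (hk : IsPosKernel k) (hl : IsPosKernel l) :
    IsPosKernel (fun x y => k x y + l x y) := by
  intro n z c
  have := add_nonneg (hk n z c) (hl n z c)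
  simpa only [mul_add, Finset.sum_add_distrib] using this

lemma posk_mul {k l : X → X → ℂ} (hk : IsPosKernel k) (hl : IsPosKernel l) :
    IsPosKernel (fun x y => k x y * l x y) := by
  obtain ⟨H, _, _, _, b, hb⟩ := posk_feature hk
  obtain ⟨H', _, _, _, b', hb'⟩ := posk_feature hl
  refine posk_congr (posk_of_feature (fun x => b x ⊗ₜ[ℂ] b' x)) fun x y => ?_
  rw [TensorProduct.inner_tmul, hb, hb']

lemma posk_rank_one (f : X → ℂ) : IsPosKernel (fun x y => f x * (starRingEnd ℂ) (f y)) := by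
  refine posk_congr (posk_of_feature (fun x => (starRingEnd ℂ) (f x))) fun x y => ?_
  simp [mul_comm]

lemma posk_const {r : ℂ} (hr : 0 ≤ r) : IsPosKernel (fun _ _ : X => r) := by
  obtain ⟨a, ha⟩ : ∃ a : ℝ, 0 ≤ a ∧ r = a := by
    have := Complex.le_def.mp hr
    exact ⟨r.re, this.1, Complex.ext (by simp) (by simpa using this.2.symm)⟩
  refine posk_congr (posk_rank_one (fun _ => (Real.sqrt a : ℂ))) fun x y => ?_
  rw [Complex.conj_ofReal, ← Complex.ofReal_mul, Real.mul_self_sqrt ha.1, ha.2]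

lemma posk_limit {k : ℕ → X → X → ℂ} {l : X → X → ℂ} (hk : ∀ n, IsPosKernel (k n))
    (h : ∀ x y, Filter.Tendsto (fun n => k n x y) Filter.atTop (nhds (l x y))) :
    IsPosKernel l := by
  intro n z c
  refine ge_of_tendsto' (f := fun m => ∑ i, ∑ j, (starRingEnd ℂ) (c i) * c j * k m (z i) (z j))
    (x := Filter.atTop) ?_ (fun m => hk m n z c)
  refine tendsto_finsetSum _ fun i _ => tendsto_finsetSum _ fun j _ => ?_
  exact (h _ _).const_mul _

lemma posk_diag {k : X → X → ℂ} (hk : IsPosKernel k) (x : X) : 0 ≤ k x x := by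
  simpa using hk 1 (fun _ => x) (fun _ => 1)

lemma posk_norm_lt {p : X → X → ℂ} (hp : IsPosKernel p) (h1 : ∀ x, p x x < 1) (x y : X) :
    ‖p x y‖ < 1 := by
  obtain ⟨H, _, _, _, b, hb⟩ := posk_feature hp
  have hb1 : ∀ x, ‖b x‖ < 1 := by
    intro x
    have := h1 x
    rw [hb, inner_self_eq_norm_sq_to_K] at this
    have h2 : ‖b x‖ ^ 2 < 1 := by
      have := (Complex.lt_def.mp this).1
      simpa [← Complex.ofReal_pow] using this
    nlinarith [norm_nonneg (b x)]
  rw [hb]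
  have := norm_inner_le_norm (𝕜 := ℂ) (b x) (b y)
  nlinarith [norm_nonneg (b x), norm_nonneg (b y), hb1 x, hb1 y]

lemma posk_geom {p : X → X → ℂ} (hp : IsPosKernel p) (h1 : ∀ x y, ‖p x y‖ < 1) :
    IsPosKernel (fun x y => (1 - p x y)⁻¹) := by
  have hpow : ∀ n, IsPosKernel (fun x y => p x y ^ n) := by
    intro n
    induction n with
    | zero => simpa using posk_const (X := X) (zero_le_one)
    | succ n ih => simpa [pow_succ] using posk_mul ih hp
  refine posk_limit (k := fun n x y => ∑ i ∈ Finset.range n, p x y ^ i) ?_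
    (fun x y => (hasSum_geometric_of_norm_lt_one (h1 x y)).tendsto_sum_nat)
  intro n
  induction n with
  | zero => simpa using posk_const (X := X) (le_refl 0)
  | succ n ih => simpa [Finset.sum_range_succ] using posk_add ih (hpow n)

lemma posk_kerShift {k : X → X → ℂ} (hk : IsPosKernel k) (z : X) (hz : 0 < k z z) :
    IsPosKernel (kerShift k z) := by
  obtain ⟨H, _, _, _, b, hb⟩ := posk_feature hk
  refine posk_congr (posk_of_feature (fun x => b x - (k z x / k z z) • b z)) fun x y => ?_
  simp only [inner_sub_left, inner_sub_right, inner_smul_left, inner_smul_right, ← hb, map_div₀,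
    posk_herm hk, kerShift]
  have := hz.ne'
  field_simp
  ring

end API

section Suff
universe u v w

def pickKer {X : Type u} (k ℓ : X → X → ℂ) {n N : ℕ}
    (z : Fin n → X) (W : Fin n → Matrix (Fin N) (Fin N) ℂ) (x y : Fin n × Fin N) : ℂ :=
  ℓ (z x.1) (z y.1) * (1 : Matrix (Fin N) (Fin N) ℂ) x.2 y.2
    - k (z x.1) (z y.1) * (W x.1 * (W y.1)ᴴ) x.2 y.2

lemma pick_sum {X : Type u} (k ℓ : X → X → ℂ) {n N : ℕ}
    (z : Fin n → X) (W : Fin n → Matrix (Fin N) (Fin N) ℂ) (u : Fin n → Fin N → ℂ) :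
    ∑ i, ∑ j,
      star (u i) ⬝ᵥ ((ℓ (z i) (z j) • (1 : Matrix (Fin N) (Fin N) ℂ)
        - k (z i) (z j) • (W i * (W j)ᴴ)) *ᵥ u j)
    = ∑ x : Fin n × Fin N, ∑ y : Fin n × Fin N,
        (starRingEnd ℂ) (u x.1 x.2) * u y.1 y.2 * pickKer k ℓ z W x y := by
  simp only [Fintype.sum_prod_type]
  refine Finset.sum_congr rfl fun i _ => ?_
  rw [Finset.sum_comm (s := (Finset.univ : Finset (Fin N)))]
  refine Finset.sum_congr rfl fun j _ => ?_
  simp only [dotProduct, mulVec, Finset.mul_sum, pickKer]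
  refine Finset.sum_congr rfl fun a _ => Finset.sum_congr rfl fun c _ => ?_
  simp only [Pi.star_apply, Matrix.sub_apply, Matrix.smul_apply, smul_eq_mul, RCLike.star_def]
  ring

lemma pick_iff {X : Type u} (k ℓ : X → X → ℂ) {n N : ℕ}
    (z : Fin n → X) (W : Fin n → Matrix (Fin N) (Fin N) ℂ) :
    PickBlockPSD k ℓ z W ↔ IsPosKernel (pickKer k ℓ z W) := by
  constructor
  · intro h
    refine posk_of_fintype fun c => ?_
    have := h (fun i a => c (i, a))
    rw [pick_sum] at this
    exact this
  · intro h u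
    rw [pick_sum]
    exact posk_sum h (fun x => x) (fun x => u x.1 x.2)

lemma lurking_s7 {E F : Type*} [NormedAddCommGroup E] [InnerProductSpace ℂ E]
    [NormedAddCommGroup F] [InnerProductSpace ℂ F] {ι : Type*} [Fintype ι] [DecidableEq ι]
    (x : ι → E) (y : ι → F) (h : ∀ i j, ⟪x i, x j⟫_ℂ = ⟪y i, y j⟫_ℂ) :
    ∃ T : E →L[ℂ] F, (∀ v, ‖T v‖ ≤ ‖v‖) ∧ ∀ i, T (x i) = y i := by
  let L1 := Fintype.linearCombination ℂ x
  let L2 := Fintype.linearCombination ℂ y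
  have hn : ∀ c, ‖L1 c‖ = ‖L2 c‖ := by
    intro c
    have : ⟪L1 c, L1 c⟫_ℂ = ⟪L2 c, L2 c⟫_ℂ := by
      simp only [L1, L2, Fintype.linearCombination_apply]
      rw [sum_inner, sum_inner]
      refine Finset.sum_congr rfl fun i _ => ?_
      rw [inner_sum, inner_sum]
      refine Finset.sum_congr rfl fun j _ => ?_
      simp only [inner_smul_left, inner_smul_right, h]
    rw [inner_self_eq_norm_sq_to_K, inner_self_eq_norm_sq_to_K] at this
    have h2 : ‖L1 c‖ ^ 2 = ‖L2 c‖ ^ 2 := by exact_mod_cast this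
    exact (sq_eq_sq₀ (norm_nonneg _) (norm_nonneg _)).mp h2
  obtain ⟨g, hg⟩ := LinearMap.exists_rightInverse_of_surjective L1.rangeRestrict
    L1.range_rangeRestrict
  have hg' : ∀ v : L1.range, L1 (g v) = v := by
    intro v
    have := congrArg Subtype.val (LinearMap.congr_fun hg v)
    simpa using this
  let P := L1.range.orthogonalProjectionOnto
  let T0 : E →ₗ[ℂ] F := (L2 ∘ₗ g) ∘ₗ (P : E →ₗ[ℂ] L1.range)
  have hT : ∀ v, ‖T0 v‖ ≤ ‖v‖ := by
    intro v
    have : ‖T0 v‖ = ‖P v‖ := by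
      change ‖L2 (g (P v))‖ = _
      rw [← hn, hg']
      rfl
    rw [this]
    exact L1.range.norm_orthogonalProjectionOnto_apply_le v
  refine ⟨T0.mkContinuous 1 (by simpa using hT), fun v => hT v, fun i => ?_⟩
  have hx : L1 (Pi.single i 1) = x i := by simp [L1]
  have hy : L2 (Pi.single i 1) = y i := by simp [L2]
  have hP : (P (x i) : E) = x i := by
    apply Submodule.starProjection_eq_self_iff.mpr
    exact ⟨_, hx⟩
  change L2 (g (P (x i))) = y i
  rw [← hy, ← sub_eq_zero, ← map_sub, ← norm_eq_zero, ← hn, map_sub, hg', hP, hx, sub_self,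
    norm_zero]

lemma posk_contr {X : Type u} {E F : Type*} [NormedAddCommGroup E] [InnerProductSpace ℂ E]
    [NormedAddCommGroup F] [InnerProductSpace ℂ F] (T : E →L[ℂ] F) (hT : ∀ v, ‖T v‖ ≤ ‖v‖)
    (x : X → E) : IsPosKernel (fun a b => ⟪x a, x b⟫_ℂ - ⟪T (x a), T (x b)⟫_ℂ) := by
  intro n z c
  have key : ∀ {G : Type _} [NormedAddCommGroup G] [InnerProductSpace ℂ G] (y : X → G),
    ∑ i, ∑ j, (starRingEnd ℂ) (c i) * c j * ⟪y (z i), y (z j)⟫_ℂ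
      = ((‖∑ i, c i • y (z i)‖ ^ 2 : ℝ) : ℂ) := by
    intro G _ _ y
    have := inner_self_eq_norm_sq_to_K (𝕜 := ℂ) (∑ i, c i • y (z i))
    rw [sum_inner] at this
    push_cast
    refine Eq.trans ?_ this
    refine Finset.sum_congr rfl fun i _ => ?_
    rw [inner_sum]
    refine Finset.sum_congr rfl fun j _ => ?_
    rw [inner_smul_left, inner_smul_right]
    ring
  have key2 : ∀ {G : Type _} [NormedAddCommGroup G] [InnerProductSpace ℂ G] (y : X → G),
    ∑ i, ∑ j, (starRingEnd ℂ) (c i) * c j * ⟪y (z i), y (z j)⟫_ℂ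
      = ((‖∑ i, c i • y (z i)‖ ^ 2 : ℝ) : ℂ) := by
    intro G _ _ y
    have := inner_self_eq_norm_sq_to_K (𝕜 := ℂ) (∑ i, c i • y (z i))
    rw [sum_inner] at this
    push_cast
    refine Eq.trans ?_ this
    refine Finset.sum_congr rfl fun i _ => ?_
    rw [inner_sum]
    refine Finset.sum_congr rfl fun j _ => ?_
    rw [inner_smul_left, inner_smul_right]
    ring
  simp only [mul_sub, Finset.sum_sub_distrib]
  rw [key x, key2 (fun a => T (x a)), ← Complex.ofReal_sub]
  apply Complex.zero_le_real.mpr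
  have h1 := hT (∑ i, c i • x (z i))
  rw [map_sum] at h1
  simp only [map_smul] at h1
  have := pow_le_pow_left₀ (norm_nonneg _) h1 2
  linarith

/-- fixed points of the colligation -/
lemma fixpt {E H K : Type*} [NormedAddCommGroup E] [InnerProductSpace ℂ E]
    [NormedAddCommGroup H] [InnerProductSpace ℂ H]
    [NormedAddCommGroup K] [InnerProductSpace ℂ K] [CompleteSpace K]
    (T : WithLp 2 (E × (H ⊗[ℂ] K)) →L[ℂ] WithLp 2 (E × K)) (hT : ∀ v, ‖T v‖ ≤ ‖v‖)
    (b : H) (hb : ‖b‖ < 1) (e : E) :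
    ∃ κ : K, (T (WithLp.toLp 2 (e, b ⊗ₜ[ℂ] κ))).snd = κ ∧
      ∀ κ', (T (WithLp.toLp 2 (e, b ⊗ₜ[ℂ] κ'))).snd = κ' → κ' = κ := by
  have hl : ∀ κ κ' : K, dist (T (WithLp.toLp 2 (e, b ⊗ₜ[ℂ] κ))).snd
      (T (WithLp.toLp 2 (e, b ⊗ₜ[ℂ] κ'))).snd ≤ ‖b‖ * dist κ κ' := by
    intro κ κ'
    rw [dist_eq_norm, dist_eq_norm, ← WithLp.sub_snd, ← map_sub]
    refine (WithLp.norm_snd_le _ _).trans ((hT _).trans (le_of_eq ?_))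
    rw [← TensorProduct.norm_tmul (𝕜 := ℂ), TensorProduct.tmul_sub, ← WithLp.toLp_sub]
    simp
  have hc : ContractingWith ⟨‖b‖, norm_nonneg b⟩
      (fun κ : K => (T (WithLp.toLp 2 (e, b ⊗ₜ[ℂ] κ))).snd) :=
    ⟨hb, LipschitzWith.of_dist_le_mul hl⟩
  refine ⟨hc.fixedPoint, hc.fixedPoint_isFixedPt, fun κ' h => ?_⟩
  exact hc.fixedPoint_unique h

theorem cp_of {X : Type u} {p s : X → X → ℂ} (hp : IsPosKernel p) (h1 : ∀ x, p x x < 1)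
    (d : X → ℂ) (hd : ∀ x, d x ≠ 0)
    (hs : ∀ x y, s x y = d x * (starRingEnd ℂ) (d y) * (1 - p x y)⁻¹) :
    IsCompletePickPair s s := by
  have hlt := posk_norm_lt hp h1
  have hne : ∀ x y, 1 - p x y ≠ 0 := by
    intro x y h
    have := hlt x y
    rw [← sub_eq_zero.mp h] at this
    simp at this
  have hspos : IsPosKernel s := posk_congr (posk_mul (posk_rank_one d) (posk_geom hp hlt)) hs
  obtain ⟨H, _, _, _, b, hb⟩ := posk_feature hp
  have hb1 : ∀ x, ‖b x‖ < 1 := by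
    intro x
    have h2 := hlt x x
    rw [hb, inner_self_eq_norm_sq_to_K] at h2
    simp at h2
    exact h2
  intro n N _ _ z W hW
  rw [pick_iff] at hW
  obtain ⟨K, _, _, _, γ, hγ⟩ := posk_feature hW
  have hdc : ∀ x, (starRingEnd ℂ) (d x) ≠ 0 := fun x => by simpa using hd x
  let g : Fin n × Fin N → K := fun x => ((starRingEnd ℂ) (d (z x.1)))⁻¹ • γ x
  have hg : ∀ x y, (1 - p (z x.1) (z y.1)) * ⟪g x, g y⟫_ℂ
      = (1 : Matrix (Fin N) (Fin N) ℂ) x.2 y.2 - (W x.1 * (W y.1)ᴴ) x.2 y.2 := by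
    intro x y
    simp only [g, inner_smul_left, inner_smul_right, ← hγ, pickKer, hs, map_inv₀,
      Complex.conj_conj]
    have e1 := hd (z x.1)
    have e2 := hdc (z y.1)
    have e3 := hne (z x.1) (z y.1)
    field_simp
  let ε : Fin N → EuclideanSpace ℂ (Fin N) := fun a => EuclideanSpace.single a 1
  have hε : ∀ a c, ⟪ε a, ε c⟫_ℂ = (1 : Matrix (Fin N) (Fin N) ℂ) a c := by
    intro a c
    simp [ε, Matrix.one_apply, EuclideanSpace.inner_single_left]
  let ρ : Matrix (Fin N) (Fin N) ℂ → Fin N → EuclideanSpace ℂ (Fin N) :=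
    fun M a => WithLp.toLp 2 (fun t => (starRingEnd ℂ) (M a t))
  have hρ : ∀ M M' a c, ⟪ρ M a, ρ M' c⟫_ℂ = (M * M'ᴴ) a c := by
    intro M M' a c
    simp [ρ, Matrix.mul_apply, PiLp.inner_apply, mul_comm]
  obtain ⟨T, hT, hTx⟩ := lurking_s7
    (fun x : Fin n × Fin N => (WithLp.toLp 2 (ε x.2, b (z x.1) ⊗ₜ[ℂ] g x) :
      WithLp 2 (EuclideanSpace ℂ (Fin N) × (H ⊗[ℂ] K))))
    (fun x : Fin n × Fin N => (WithLp.toLp 2 (ρ (W x.1) x.2, g x) : WithLp 2 (EuclideanSpace ℂ (Fin N) × K))) (by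
      intro x y
      simp only [WithLp.prod_inner_apply, TensorProduct.inner_tmul, hε, hρ, ← hb]
      linear_combination -(hg x y))
  choose κ hκ hκu using fun (x : X) (a : Fin N) => fixpt T hT (b x) (hb1 x) (ε a)
  let ξ : X × Fin N → WithLp 2 (EuclideanSpace ℂ (Fin N) × (H ⊗[ℂ] K)) :=
    fun x => WithLp.toLp 2 (ε x.2, b x.1 ⊗ₜ[ℂ] κ x.1 x.2)
  let Φ : X → Matrix (Fin N) (Fin N) ℂ :=
    fun x => Matrix.of fun a t => (starRingEnd ℂ) ((T (ξ (x, a))).fst t)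
  have hΦρ : ∀ x a, ρ (Φ x) a = (T (ξ (x, a))).fst := by
    intro x a
    ext t
    simp [ρ, Φ]
  refine ⟨Φ, ?_, ?_⟩
  · have hQ := posk_contr T hT ξ
    have hκk := posk_of_feature (fun x : X × Fin N => κ x.1 x.2)
    have hs' := posk_comp hspos (fun x : X × Fin N => x.1)
    have hd' := posk_rank_one (fun x : X × Fin N => d x.1)
    have tot := posk_add (posk_mul hs' hQ) (posk_mul hd' hκk)
    intro m y
    rw [pick_iff]
    refine posk_congr (posk_comp tot (fun x : Fin m × Fin N => (y x.1, x.2))) fun x x' => ?_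
    simp only [WithLp.prod_inner_apply, pickKer]
    have e1 := hκ (y x.1) x.2
    have e2 := hκ (y x'.1) x'.2
    change (T (ξ (y x.1, x.2))).snd = _ at e1
    change (T (ξ (y x'.1, x'.2))).snd = _ at e2
    simp only [WithLp.ofLp_snd, WithLp.ofLp_fst, e1, e2, ← hΦρ, hρ]
    simp only [ξ, WithLp.toLp_fst, WithLp.toLp_snd, TensorProduct.inner_tmul, hε, ← hb, hs]
    have e3 := hne (y x.1) (y x'.1)
    field_simp
    ring
  · intro i
    have hk : ∀ a, κ (z i) a = g (i, a) := by
      intro a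
      refine (hκu (z i) a (g (i, a)) ?_).symm
      have := hTx (i, a)
      simp only at this
      rw [this]
      rfl
    ext a t
    have := hTx (i, a)
    simp only at this
    simp [Φ, ξ, hk, this, ρ]

end Suff

section Nec
universe u

def FF {X : Type u} (s : X → X → ℂ) (z w v : X) : ℂ := 1 - s w z * s z v / (s z z * s w v)

lemma c_inv_pos {r : ℂ} (h : 0 < r) : 0 < r⁻¹ := by
  rw [Complex.lt_def] at h
  have e : r = (r.re : ℂ) := Complex.ext (by simp) (by simpa using h.2.symm)
  rw [e, ← Complex.ofReal_inv]
  exact Complex.zero_lt_real.mpr (inv_pos.mpr h.1)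

lemma posk_slice {X : Type u} {s : X → X → ℂ} (hs : IsPosKernel s) (hd : ∀ x, 0 < s x x)
    (z : X) : IsPosKernel (fun w v => s w z * s z v / s z z) := by
  have h1 : (0 : ℂ) ≤ (s z z)⁻¹ := (c_inv_pos (hd z)).le
  refine posk_congr (posk_mul (posk_rank_one (fun w => s w z)) (posk_const h1)) fun w v => ?_
  rw [posk_herm hs, div_eq_mul_inv]

open scoped MatrixOrder Matrix.Norms.L2Operator in
lemma gram_factor {n : ℕ} {G : Fin n → Fin n → ℂ} (hG : IsPosKernel G) :
    ∃ M : Fin n → Fin n → ℂ, ∀ i j, G i j = ∑ t, M i t * (starRingEnd ℂ) (M j t) := by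
  have h : (Matrix.of G).PosSemidef := by
    rw [Matrix.posSemidef_iff_dotProduct_mulVec]
    refine ⟨?_, fun c => ?_⟩
    · ext i j
      simp [posk_herm hG]
    · have := posk_sum hG (fun i => i) c
      convert this using 1
      simp only [dotProduct, mulVec, Finset.mul_sum]
      refine Finset.sum_congr rfl fun i _ => Finset.sum_congr rfl fun j _ => ?_
      simp
      ring
  obtain ⟨B, hB⟩ := CStarAlgebra.nonneg_iff_eq_star_mul_self.mp h.nonneg
  refine ⟨fun i t => (starRingEnd ℂ) (B t i), fun i j => ?_⟩
  have := congrFun (congrFun hB i) j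
  simpa [Matrix.mul_apply, Matrix.star_eq_conjTranspose] using this

lemma nec {X : Type u} {s : X → X → ℂ} (hs : IsPosKernel s) (hcp : IsCompletePickPair s s)
    (hd : ∀ x, 0 < s x x) (hnv : ∀ x y, s x y ≠ 0) (n : ℕ) :
    ∀ (z : X) (x : Fin n → X), IsPosKernel (fun i j => FF s z (x i) (x j)) := by
  induction n with
  | zero =>
    intro z x
    exact posk_of_fintype (by simp)
  | succ n ih =>
    intro z x
    have hG : IsPosKernel (fun i j => FF s (x 0) (x i) (x j)) := by
      refine posk_of_fintype fun c => ?_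
      have h0 : ∀ v, FF s (x 0) (x 0) v = 0 := by
        intro v
        have h1 := hnv (x 0) (x 0)
        have h2 := hnv (x 0) v
        simp only [FF]
        field_simp
        ring
      have h0' : ∀ v, FF s (x 0) v (x 0) = 0 := by
        intro v
        have h1 := hnv (x 0) (x 0)
        have h2 := hnv v (x 0)
        simp only [FF]
        field_simp
        ring
      simp only [Fin.sum_univ_succ, h0, h0', mul_zero, Finset.sum_const_zero, zero_add, add_zero]
      exact posk_sum (ih (x 0) (fun i => x i.succ)) (fun i => i) (fun i => c i.succ)
    obtain ⟨M, hM⟩ := gram_factor hG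
    let W : Fin (n + 1) → Matrix (Fin (n + 1)) (Fin (n + 1)) ℂ :=
      fun i => Matrix.of fun a t => if a = 0 then M i t else 0
    have hW : ∀ i j a c, (W i * (W j)ᴴ) a c
        = (if a = 0 then 1 else 0) * (if c = 0 then 1 else 0) * FF s (x 0) (x i) (x j) := by
      intro i j a c
      rw [hM]
      by_cases ha : a = 0 <;> by_cases hc : c = 0 <;> simp [W, Matrix.mul_apply, ha, hc]
    have hpick : PickBlockPSD s s x W := by
      rw [pick_iff]
      have k1 := posk_of_feature (fun a : Fin (n + 1) × Fin (n + 1) =>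
        if a.2 = 0 then 0 else EuclideanSpace.single a.2 (1 : ℂ))
      have k2 := posk_comp hs (fun a : Fin (n + 1) × Fin (n + 1) => x a.1)
      have k3 := posk_comp (posk_slice hs hd (x 0)) (fun a : Fin (n + 1) × Fin (n + 1) => x a.1)
      have k4 := posk_rank_one (fun a : Fin (n + 1) × Fin (n + 1) => if a.2 = 0 then (1 : ℂ) else 0)
      refine posk_congr (posk_add (posk_mul k2 k1) (posk_mul k4 k3)) fun a c => ?_
      have e1 := hnv (x 0) (x 0)
      have e2 := hnv (x a.1) (x c.1)
      rw [pickKer, hW, FF]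
      by_cases ha : a.2 = 0 <;> by_cases hc : c.2 = 0
      · simp [ha, hc, Matrix.one_apply]
        field_simp
        ring
      · simp [ha, hc, Matrix.one_apply, Ne.symm hc]
      · simp [ha, hc, Matrix.one_apply]
      · simp [ha, hc, Matrix.one_apply, EuclideanSpace.inner_single_left]
    obtain ⟨Φ, hΦ, hΦx⟩ := hcp (n + 1) (n + 1) (by omega) (by omega) x W hpick
    let φ : X → X → ℂ := fun w v => (Φ w * (Φ v)ᴴ) 0 0
    have hφ : IsPosKernel φ := by
      refine posk_congr (posk_of_feature (fun w =>
        (WithLp.toLp 2 (fun t => (starRingEnd ℂ) (Φ w 0 t)) : EuclideanSpace ℂ (Fin (n + 1)))))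
        fun w v => ?_
      simp [φ, Matrix.mul_apply, PiLp.inner_apply, mul_comm]
    have hφx : ∀ i j, φ (x i) (x j) = FF s (x 0) (x i) (x j) := by
      intro i j
      simp [φ, hΦx, hW]
    have hsφ : IsPosKernel (fun w v => s w v * (1 - φ w v)) := by
      intro m y c
      have := (pick_iff _ _ _ _).mp (hΦ m y)
      have := posk_sum this (fun i : Fin m => (i, 0)) c
      convert this using 6
      simp [pickKer, φ]
      ring
    have hR := posk_add hsφ (posk_mul (posk_slice hs hd z) hφ)
    have hR' := posk_kerShift hR z (by
      have := hd z
      have e := hnv z z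
      convert this using 1
      field_simp
      ring)
    have hfin := posk_mul (posk_comp hR' x) (posk_mul (posk_const (hd (x 0)).le)
      (posk_rank_one (fun i => (s (x i) (x 0))⁻¹)))
    refine posk_congr hfin fun i j => ?_
    simp only [kerShift, hφx, map_inv₀, posk_herm hs]
    have e1 := hnv z z
    have e2 := hnv (x i) (x 0)
    have e3 := hnv (x 0) (x j)
    have e4 := hnv (x 0) (x 0)
    have e5 := hnv (x i) (x j)
    have f1 : s (x i) z * (1 - φ (x i) z) + s (x i) z * s z z / s z z * φ (x i) z = s (x i) z := by
      field_simp
      ring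
    have f2 : s z (x j) * (1 - φ z (x j)) + s z z * s z (x j) / s z z * φ z (x j) = s z (x j) := by
      field_simp
      ring
    have f3 : s z z * (1 - φ z z) + s z z * s z z / s z z * φ z z = s z z := by
      field_simp
      ring
    rw [f1, f2, f3]
    simp only [FF]
    field_simp
    ring

lemma nec' {X : Type u} {s : X → X → ℂ} (hs : IsPosKernel s) (hcp : IsCompletePickPair s s)
    (hd : ∀ x, 0 < s x x) (hnv : ∀ x y, s x y ≠ 0) (z : X) : IsPosKernel (FF s z) :=
  fun n x c => posk_sum (nec hs hcp hd hnv n z x) (fun i => i) c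

end Nec

section Main
universe u

lemma h_aux {X : Type u} {h : X → X → ℂ} (hh : IsPosKernel h) (z : X) (hz : 0 < 1 - h z z) :
    IsPosKernel (fun w v => (1 - h w z) * (1 - h z v) / (1 - h z z) - 1 + h w v) := by
  have n1 := hz.ne'
  by_cases h0 : h z z = 0
  · obtain ⟨H, _, _, _, b, hb⟩ := posk_feature hh
    have hbz : b z = 0 := by
      rw [hb] at h0
      exact inner_self_eq_zero.mp h0
    refine posk_congr hh fun w v => ?_
    have e1 : h w z = 0 := by rw [hb, hbz, inner_zero_right]
    have e2 : h z v = 0 := by rw [hb, hbz, inner_zero_left]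
    simp [e1, e2, h0]
  · have hp : 0 < h z z := lt_of_le_of_ne (posk_diag hh z) (Ne.symm h0)
    have k1 := posk_kerShift hh z hp
    have k2 := posk_mul (posk_rank_one (fun w => h z z - h w z))
      (posk_const (c_inv_pos (mul_pos hp hz)).le)
    refine posk_congr (posk_add k1 k2) fun w v => ?_
    simp only [kerShift, map_sub, posk_herm hh]
    field_simp
    ring

lemma b_to_a {X : Type u} {k ℓ s : X → X → ℂ} (hkd : ∀ x, 0 < k x x) 
    (hnv : ∀ z w, ℓ z w ≠ 0) (hS : IsStrongShimorinCertificate k ℓ s) :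
    IsShimorinCertificate k ℓ (FF s) := by
  obtain ⟨hs, hcp, h, g, hh, hg, hks, hls⟩ := hS
  have sn : ∀ z w, s z w ≠ 0 := fun z w h0 => hnv z w (by rw [hls, h0, zero_mul])
  have gn : ∀ z w, g z w ≠ 0 := fun z w h0 => hnv z w (by rw [hls, h0, mul_zero])
  have sd : ∀ x, 0 < s x x := fun x => lt_of_le_of_ne (posk_diag hs x) (sn x x).symm
  have gd : ∀ x, 0 < g x x := fun x => lt_of_le_of_ne (posk_diag hg x) (gn x x).symm
  have hd : ∀ x, 0 < 1 - h x x := by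
    intro x
    have := mul_pos (hkd x) (c_inv_pos (sd x))
    rwa [hks, mul_assoc, mul_inv_cancel₀ (sn x x), mul_one] at this
  intro z
  have e1 := sn z z
  have e2 := gn z z
  have e3 := (hd z).ne'
  refine ⟨nec' hs hcp sd sn z, ?_, ?_⟩
  · refine posk_congr (posk_mul (posk_slice hs sd z) (posk_kerShift hg z (gd z))) fun w v => ?_
    have e4 := sn w v
    simp only [kerShift, FF, hls]
    field_simp
    ring
  · refine posk_congr (posk_mul (posk_slice hs sd z) (h_aux hh z (hd z))) fun w v => ?_
    have e4 := sn w v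
    simp only [kerShift, FF, hks]
    field_simp
    ring

lemma c_to_b {X : Type u} {k ℓ p : X → X → ℂ} (z : X)
    (hk : IsPosKernel k) (hℓ : IsPosKernel ℓ)
    (hkd : ∀ x, 0 < k x x) (hℓd : ∀ x, 0 < ℓ x x)
    (hnv : ∀ z w, ℓ z w ≠ 0) (hp : IsPosKernel p)
    (h1 : IsPosKernel (fun w v => kerShift ℓ z w v - p w v * ℓ w v))
    (h2 : IsPosKernel (fun w v => p w v * k w v - kerShift k z w v)) :
    ∃ s, IsStrongShimorinCertificate k ℓ s := by
  have hp1 : ∀ x, 0 < 1 - p x x := by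
    intro x
    have a1 := posk_diag h1 x
    have a2 : 0 < ℓ x z * ℓ z x / ℓ z z :=
      lt_of_le_of_ne (posk_diag (posk_slice hℓ hℓd z) x)
        (div_ne_zero (mul_ne_zero (hnv _ _) (hnv _ _)) (hnv _ _)).symm
    have a3 := add_pos_of_nonneg_of_pos a1 a2
    have a4 := mul_pos a3 (c_inv_pos (hℓd x))
    convert a4 using 1
    have := hnv x x
    simp only [kerShift]
    field_simp
    ring
  have hp2 : ∀ x, p x x < 1 := fun x => sub_pos.mp (hp1 x)
  have hlt := posk_norm_lt hp hp2
  have hne : ∀ x y, 1 - p x y ≠ 0 := by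
    intro x y h
    have := hlt x y
    rw [← sub_eq_zero.mp h] at this
    simp at this
  have hkz : ∀ x, k x z ≠ 0 := by
    intro x h0
    have a1 := posk_diag h2 x
    have a2 := mul_pos (hp1 x) (hkd x)
    have a3 := add_pos_of_nonneg_of_pos a1 a2
    have : p x x * k x x - kerShift k z x x + (1 - p x x) * k x x = 0 := by
      simp only [kerShift, h0]
      ring
    rw [this] at a3
    exact lt_irrefl _ a3
  obtain ⟨r, hr, hr0⟩ : ∃ r : ℝ, (r : ℂ) * r = k z z ∧ (r : ℂ) ≠ 0 := by
    have a := Complex.lt_def.mp (hkd z)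
    have e : k z z = ((k z z).re : ℂ) := Complex.ext (by simp) (by simpa using a.2.symm)
    have e2 : ((Real.sqrt (k z z).re : ℝ) : ℂ) * (Real.sqrt (k z z).re : ℝ) = k z z := by
      rw [← Complex.ofReal_mul, Real.mul_self_sqrt a.1.le, ← e]
    refine ⟨Real.sqrt (k z z).re, e2, fun h0 => (hkd z).ne' ?_⟩
    rw [← e2, h0, zero_mul]
  let d : X → ℂ := fun x => k x z / r
  have hd : ∀ x, d x ≠ 0 := fun x => div_ne_zero (hkz x) hr0
  have hdc : ∀ x, (starRingEnd ℂ) (d x) ≠ 0 := fun x => by simpa using hd x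
  have hdd : ∀ x y, k x z * k z y / k z z = d x * (starRingEnd ℂ) (d y) := by
    intro x y
    simp only [d, map_div₀, posk_herm hk, Complex.conj_ofReal]
    rw [← hr]
    field_simp
  have hinv := posk_rank_one (fun x => (d x)⁻¹)
  refine ⟨fun x y => d x * (starRingEnd ℂ) (d y) * (1 - p x y)⁻¹,
    posk_mul (posk_rank_one d) (posk_geom hp hlt), cp_of hp hp2 d hd (fun _ _ => rfl),
    fun x y => 1 - k x y * (1 - p x y) / (d x * (starRingEnd ℂ) (d y)),
    fun x y => ℓ x y * (1 - p x y) / (d x * (starRingEnd ℂ) (d y)), ?_, ?_, ?_, ?_⟩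
  · refine posk_congr (posk_mul h2 hinv) fun x y => ?_
    simp only [kerShift, hdd, map_inv₀]
    have e1 := hd x
    have e2 := hdc y
    field_simp
    ring
  · refine posk_congr (posk_mul (posk_add h1 (posk_slice hℓ hℓd z)) hinv) fun x y => ?_
    simp only [kerShift, map_inv₀]
    have e1 := hd x
    have e2 := hdc y
    field_simp
    ring
  · intro x y
    have e1 := hd x
    have e2 := hdc y
    have e3 := hne x y
    field_simp
    ring
  · intro x y
    have e1 := hd x
    have e2 := hdc y
    have e3 := hne x y
    field_simp

end Main

/-- For `ℓ` non-vanishing, the following are equivalent: existence of a Shimorin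
certificate, existence of a strong Shimorin certificate, and existence of a single
positive kernel `p` and a point `z₀` with `ℓ^{z₀} ⪰ p·ℓ` and `p·k ⪰ k^{z₀}`. -/
theorem certificate_equivalences {X : Type*} [Nonempty X] (k ℓ : X → X → ℂ)
    (hk : IsPosKernel k) (hℓ : IsPosKernel ℓ)
    (hkd : ∀ x, 0 < k x x) (hℓd : ∀ x, 0 < ℓ x x)
    (hnv : ∀ z w, ℓ z w ≠ 0) :
    ((∃ p, IsShimorinCertificate k ℓ p) ↔ ∃ s, IsStrongShimorinCertificate k ℓ s) ∧
    ((∃ s, IsStrongShimorinCertificate k ℓ s) ↔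
      ∃ (p : X → X → ℂ) (z₀ : X), IsPosKernel p ∧
        IsPosKernel (fun w v => kerShift ℓ z₀ w v - p w v * ℓ w v) ∧
        IsPosKernel (fun w v => p w v * k w v - kerShift k z₀ w v)) := by
  have ba : (∃ s, IsStrongShimorinCertificate k ℓ s) → ∃ p, IsShimorinCertificate k ℓ p :=
    fun ⟨s, hs⟩ => ⟨_, b_to_a hkd hnv hs⟩
  have cb : (∃ (p : X → X → ℂ) (z₀ : X), IsPosKernel p ∧
        IsPosKernel (fun w v => kerShift ℓ z₀ w v - p w v * ℓ w v) ∧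
        IsPosKernel (fun w v => p w v * k w v - kerShift k z₀ w v)) →
      ∃ s, IsStrongShimorinCertificate k ℓ s :=
    fun ⟨p, z, hp, h1, h2⟩ => c_to_b z hk hℓ hkd hℓd hnv hp h1 h2
  have ac : (∃ p, IsShimorinCertificate k ℓ p) → (∃ (p : X → X → ℂ) (z₀ : X), IsPosKernel p ∧
        IsPosKernel (fun w v => kerShift ℓ z₀ w v - p w v * ℓ w v) ∧
        IsPosKernel (fun w v => p w v * k w v - kerShift k z₀ w v)) := by
    rintro ⟨p, hp⟩
    let z : X := Classical.arbitrary X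
    exact ⟨p z, z, hp z⟩
  exact ⟨⟨fun h => cb (ac h), ba⟩, ⟨fun h => ac (ba h), cb⟩⟩
end
end
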